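/- For a normal completely positive map φ : B(K) → B(K), the following are equivalent: (i) φ is k-superpositive; (ii) ⟨C_ψ, D_φ⟩ ≥ 0 for every ψ ∈ P^σ_k; (iii) φ ∘ ψ is completely positive for every ψ ∈ P^σ_k; (iv) φ̃(C_ψ) is positive for every ψ ∈ P^σ_k; (v) ψ̃_*(D_φ) is positive for every ψ ∈ P^σ_k; (vi) D_φ ∈ S_k; (vii) φ̃_*(ω_{x,x}) ∈ S_k for every x ∈ H; (viii) φ is k-partially entanglement breaking, i.e. φ̃_* sends every normal state in T(H) into S_k. -/

import Mathlib

set_option synthInstance.maxHeartbeats 1000000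
set_option maxHeartbeats 1000000

noncomputable section

open scoped InnerProductSpace ComplexOrder
open ContinuousLinearMap

local notation "⟪" x ", " y "⟫" => @inner ℂ _ _ x y

namespace ChoiInf

variable {H : Type*} [NormedAddCommGroup H] [InnerProductSpace ℂ H] [CompleteSpace H]

/-- The rank one operator `x ⊠ y : z ↦ (z|y)·x = ⟪y, z⟫ • x`
(inner products written with Mathlib's convention: conjugate linear in the
first variable, so that the paper's `(z|y)` is `⟪y, z⟫`). -/
def rankOne (x y : H) : H →L[ℂ] H := (innerSL ℂ y).smulRight x

/-- The trace of an operator, computed relative to a Hilbert basis: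
`Tr X = Σᵢ (X eᵢ | eᵢ) = Σᵢ ⟪eᵢ, X eᵢ⟫`.  (For trace class operators this does
not depend on the choice of basis.) -/
def tr {ι : Type*} (b : HilbertBasis ι ℂ H) (T : H →L[ℂ] H) : ℂ :=
  ∑' i, ⟪b i, T (b i)⟫

/-- The bilinear pairing `⟨A, B⟩ = Tr (A B)` between `B(H)` and `T(H)`. -/
def pairing {ι : Type*} (b : HilbertBasis ι ℂ H) (A T : H →L[ℂ] H) : ℂ :=
  tr b (A ∘L T)

/-- Trace class operators, characterized by nuclear representations
`T = Σₙ xₙ ⊠ yₙ` with `Σₙ ‖xₙ‖‖yₙ‖ < ∞`. -/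
def IsTraceClass (T : H →L[ℂ] H) : Prop :=
  ∃ x y : ℕ → H, Summable (fun n => ‖x n‖ * ‖y n‖) ∧
    ∀ z, T z = ∑' n, ⟪y n, z⟫ • x n

/-- The trace norm, as the infimum of `Σₙ ‖xₙ‖‖yₙ‖` over all nuclear
representations `T = Σₙ xₙ ⊠ yₙ`. -/
def traceNorm (T : H →L[ℂ] H) : ℝ :=
  sInf {c : ℝ | ∃ x y : ℕ → H, HasSum (fun n => ‖x n‖ * ‖y n‖) c ∧
    ∀ z, T z = ∑' n, ⟪y n, z⟫ • x n}

/-- `(Φ, Φst)` is a dual pair:  `Φst` preserves the trace class and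
`⟨Φ A, T⟩ = ⟨A, Φst T⟩` for all trace class `T`.  A linear map `Φ` on `B(H)` is
normal (σ-weakly continuous) precisely when it admits such a predual map `Φst`. -/
def IsNormalPair {ι : Type*} (b : HilbertBasis ι ℂ H)
    (Φ Φst : (H →L[ℂ] H) →ₗ[ℂ] (H →L[ℂ] H)) : Prop :=
  (∀ T, IsTraceClass T → IsTraceClass (Φst T)) ∧
    ∀ A T, IsTraceClass T → pairing b (Φ A) T = pairing b A (Φst T)

/-- Positivity of a `k × k` matrix of operators, i.e. positivity of the
corresponding operator on `H ⊕ ⋯ ⊕ H`. -/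
def MatPos {k : ℕ} (A : Fin k → Fin k → (H →L[ℂ] H)) : Prop :=
  ∀ v : Fin k → H, 0 ≤ ∑ i, ∑ j, ⟪v i, A i j (v j)⟫

/-- The operator on `H ⊕ ⋯ ⊕ H` given by a `k × k` matrix of operators has norm `≤ c`. -/
def matNormLe {k : ℕ} (A : Fin k → Fin k → (H →L[ℂ] H)) (c : ℝ) : Prop :=
  ∀ v w : Fin k → H,
    ‖∑ i, ∑ j, ⟪w i, A i j (v j)⟫‖ ≤
      c * Real.sqrt (∑ i, ‖v i‖ ^ 2) * Real.sqrt (∑ i, ‖w i‖ ^ 2)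

/-- A von Neumann algebra is a factor when its center consists of the scalars. -/
def IsFactor (M : VonNeumannAlgebra H) : Prop :=
  ∀ T ∈ M, T ∈ M.commutant → ∃ c : ℂ, T = c • (1 : H →L[ℂ] H)

/-- `x0` is a cyclic vector for `M`. -/
def Cyclic (M : VonNeumannAlgebra H) (x0 : H) : Prop :=
  Dense {y : H | ∃ A ∈ M, A x0 = y}

/-- `x0` is a separating vector for `M`. -/
def Separating (M : VonNeumannAlgebra H) (x0 : H) : Prop :=
  ∀ A ∈ M, A x0 = 0 → A = 0

/-- `Φ` restricts on `alg(M', M)` to the map `φ̃ : A'B ↦ A'·φ(B)`.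
(Maps `φ : M → M` are encoded as linear maps on `B(H)` sending `M` into `M`;
only the restriction to `M` is relevant.) -/
def ExtendsTilde (M : VonNeumannAlgebra H)
    (φ Φ : (H →L[ℂ] H) →ₗ[ℂ] (H →L[ℂ] H)) : Prop :=
  ∀ A' ∈ M.commutant, ∀ B ∈ M, Φ (A' * B) = A' * φ B

/-- The space `CB^σ_ε(M)` of maps `φ : M → M` such that `φ̃` extends to a normal
map on `B(H)`. -/
def CBSigmaE {ι : Type*} (b : HilbertBasis ι ℂ H) (M : VonNeumannAlgebra H) :
    Set ((H →L[ℂ] H) →ₗ[ℂ] (H →L[ℂ] H)) :=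
  {φ | (∀ B ∈ M, φ B ∈ M) ∧
    ∃ Φ Φst, ExtendsTilde M φ Φ ∧ IsNormalPair b Φ Φst}

/-- `φ` is completely positive as a map on `M`. -/
def IsCPOn (M : VonNeumannAlgebra H) (φ : (H →L[ℂ] H) →ₗ[ℂ] (H →L[ℂ] H)) : Prop :=
  ∀ (k : ℕ) (A : Fin k → Fin k → (H →L[ℂ] H)), (∀ i j, A i j ∈ M) →
    MatPos A → MatPos fun i j => φ (A i j)

/-- `φ` is completely positive (on all of `B(H)`). -/
def IsCPFull (φ : (H →L[ℂ] H) →ₗ[ℂ] (H →L[ℂ] H)) : Prop :=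
  ∀ (k : ℕ) (A : Fin k → Fin k → (H →L[ℂ] H)), MatPos A → MatPos fun i j => φ (A i j)

/-- `c` is a completely bounded bound for `φ` as a map on `M`. -/
def CBBoundOn (M : VonNeumannAlgebra H) (φ : (H →L[ℂ] H) →ₗ[ℂ] (H →L[ℂ] H))
    (c : ℝ) : Prop :=
  ∀ (k : ℕ) (A : Fin k → Fin k → (H →L[ℂ] H)), (∀ i j, A i j ∈ M) →
    matNormLe A 1 → matNormLe (fun i j => φ (A i j)) c

/-- The completely bounded norm of `φ` as a map on `M`. -/
def cbNormOn (M : VonNeumannAlgebra H) (φ : (H →L[ℂ] H) →ₗ[ℂ] (H →L[ℂ] H)) : ℝ :=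
  sInf {c : ℝ | 0 ≤ c ∧ CBBoundOn M φ c}

/-- `φ` is completely bounded as a map on `M`. -/
def IsCBOn (M : VonNeumannAlgebra H) (φ : (H →L[ℂ] H) →ₗ[ℂ] (H →L[ℂ] H)) : Prop :=
  ∃ c, 0 ≤ c ∧ CBBoundOn M φ c

/-- `φ` is normal as a map on `M`: every normal functional composed with `φ`
is again normal (i.e. implemented by a trace class operator). -/
def NormalOn {ι : Type*} (b : HilbertBasis ι ℂ H) (M : VonNeumannAlgebra H)
    (φ : (H →L[ℂ] H) →ₗ[ℂ] (H →L[ℂ] H)) : Prop :=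
  ∀ T, IsTraceClass T → ∃ T', IsTraceClass T' ∧
    ∀ A ∈ M, pairing b (φ A) T = pairing b A T'

/-- The map `Ad_V : X ↦ V* X V`. -/
def AdL (V : H →L[ℂ] H) : (H →L[ℂ] H) →ₗ[ℂ] (H →L[ℂ] H) where
  toFun X := star V * X * V
  map_add' X Y := by simp [add_mul, mul_add]
  map_smul' c X := by simp [smul_mul_assoc, mul_smul_comm]

/-- `p` is a minimal (nonzero) projection in `M`. -/
def IsMinimalProjection (M : VonNeumannAlgebra H) (p : H →L[ℂ] H) : Prop :=
  p ∈ M ∧ IsIdempotentElem p ∧ IsSelfAdjoint p ∧ p ≠ 0 ∧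
    ∀ q, q ∈ M → IsIdempotentElem q → IsSelfAdjoint q → q ≠ 0 →
      q * p = q → p * q = q → q = p

/-- A factor is of type I precisely when it contains a minimal projection. -/
def IsTypeI (M : VonNeumannAlgebra H) : Prop :=
  ∃ p, IsMinimalProjection M p




variable {K : Type*} [NormedAddCommGroup K] [InnerProductSpace ℂ K] [CompleteSpace K]

/-- `T` is a Hilbert–Schmidt operator (relative to a Hilbert basis `e`;
this does not depend on the choice of `e`). -/
def IsHS {ι : Type*} (e : HilbertBasis ι ℂ K) (T : K →L[ℂ] K) : Prop :=
  Summable fun i => ‖T (e i)‖ ^ 2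

/-- A model of the Hilbert space `HS(K)` of Hilbert–Schmidt operators on `K`,
with `B(K)` acting by left multiplications `Lmul` and right multiplications
`Rmul`.  `toOp` regards a vector of `H` as an operator on `K`; its range is
exactly the set of Hilbert–Schmidt operators, and the inner product of `H` is
`(x|y) = Tr (x y*)`, i.e. `⟪x, y⟫ = Σᵢ ⟪x eᵢ, y eᵢ⟫`. -/
structure HSModel {ι : Type*} (e : HilbertBasis ι ℂ K) (H : Type*)
    [NormedAddCommGroup H] [InnerProductSpace ℂ H] [CompleteSpace H] where
  toOp : H →ₗ[ℂ] (K →L[ℂ] K)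
  inj : Function.Injective toOp
  mem_range : ∀ T : K →L[ℂ] K, IsHS e T ↔ ∃ x : H, toOp x = T
  inner_eq : ∀ x y : H, ⟪x, y⟫ = ∑' i, ⟪toOp x (e i), toOp y (e i)⟫
  Lmul : (K →L[ℂ] K) → (H →L[ℂ] H)
  Lmul_eq : ∀ a x, toOp (Lmul a x) = a ∘L toOp x
  Rmul : (K →L[ℂ] K) → (H →L[ℂ] H)
  Rmul_eq : ∀ a x, toOp (Rmul a x) = toOp x ∘L a

/-- The operator `T` has rank at most `k`. -/
def rankLE (T : K →L[ℂ] K) (k : ℕ) : Prop :=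
  Module.rank ℂ (LinearMap.range (T : K →ₗ[ℂ] K)) ≤ (k : Cardinal)

variable {H : Type*} [NormedAddCommGroup H] [InnerProductSpace ℂ H] [CompleteSpace H]
  {ι : Type*} {e : HilbertBasis ι ℂ K}

/-- `Φ` restricts to the map `φ̃ : R_y L_x ↦ R_y L_{φ(x)}` on `alg(M', M)` for
`M = L_{B(K)}`. -/
def HSExt (m : HSModel e H) (φ : (K →L[ℂ] K) →ₗ[ℂ] (K →L[ℂ] K))
    (Φ : (H →L[ℂ] H) →ₗ[ℂ] (H →L[ℂ] H)) : Prop :=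
  ∀ a x : K →L[ℂ] K, Φ (m.Rmul a ∘L m.Lmul x) = m.Rmul a ∘L m.Lmul (φ x)

/-- `φ` is `k`-positive. -/
def kPos (k : ℕ) (φ : (K →L[ℂ] K) →ₗ[ℂ] (K →L[ℂ] K)) : Prop :=
  ∀ A : Fin k → Fin k → (K →L[ℂ] K), MatPos A → MatPos fun i j => φ (A i j)

/-- `φ` is completely bounded (as a map on all of `B(K)`). -/
def IsCBFullK (φ : (K →L[ℂ] K) →ₗ[ℂ] (K →L[ℂ] K)) : Prop :=
  ∃ c, 0 ≤ c ∧ ∀ (k : ℕ) (A : Fin k → Fin k → (K →L[ℂ] K)),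
    matNormLe A 1 → matNormLe (fun i j => φ (A i j)) c

/-- `φ` belongs to `CB^σ(B(K))`: it is normal and completely bounded. -/
def NormalCB (e : HilbertBasis ι ℂ K) (φ : (K →L[ℂ] K) →ₗ[ℂ] (K →L[ℂ] K)) : Prop :=
  (∃ φst, IsNormalPair e φ φst) ∧ IsCBFullK φ

/-- The cone `𝒮_k` of `T(H)`: the trace-norm closed convex cone generated by
the `ω_{x,x} = x ⊠ x` with `rank x ≤ k` (rank as an operator on `K`). -/
def SchmidtCone (m : HSModel e H) (k : ℕ) : Set (H →L[ℂ] H) :=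
  {T | ∀ ε : ℝ, 0 < ε → ∃ (n : ℕ) (x : Fin n → H),
    (∀ i, rankLE (m.toOp (x i)) k) ∧
      traceNorm (T - ∑ i, rankOne (x i) (x i)) < ε}

/-- `ψ` belongs to the convex cone `𝔼_k` generated by the maps `Ad_V` with
`rank V ≤ k`. -/
def InEk (k : ℕ) (ψ : (K →L[ℂ] K) →ₗ[ℂ] (K →L[ℂ] K)) : Prop :=
  ∃ (n : ℕ) (V : Fin n → (K →L[ℂ] K)), (∀ i, rankLE (V i) k) ∧
    ∀ x, ψ x = ∑ i, star (V i) * x * V i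

/-- `φ` (with Choi trace-class operator `Dphi = D_φ`) is `k`-superpositive:
it lies in the `‖·‖_D`-closure of the cone `𝔼_k`, where `‖ψ‖_D = ‖D_ψ‖_{T(H)}`. -/
def kSuper {ιH : Type*} (bH : HilbertBasis ιH ℂ H) (m : HSModel e H) (x0 : H)
    (k : ℕ) (Dphi : H →L[ℂ] H) : Prop :=
  ∀ ε : ℝ, 0 < ε → ∃ ψ Ψ Ψst, InEk k ψ ∧ HSExt m ψ Ψ ∧ IsNormalPair bH Ψ Ψst ∧
    traceNorm (Dphi - Ψst (rankOne x0 x0)) < ε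

set_option linter.unusedSectionVars false

/-! ### Nuclear representations and the trace -/

section TraceClass

variable {E : Type*} [NormedAddCommGroup E] [InnerProductSpace ℂ E] [CompleteSpace E]

/-- `T = ∑ₙ xₙ ⊠ yₙ` is an absolutely convergent nuclear representation. -/
def NuclearRep (T : E →L[ℂ] E) (x y : ℕ → E) : Prop :=
  Summable (fun n => ‖x n‖ * ‖y n‖) ∧ ∀ z, T z = ∑' n, ⟪y n, z⟫ • x n

@[simp] lemma rankOne_apply (x y z : E) : rankOne x y z = ⟪y, z⟫ • x := rfl

lemma NuclearRep.summable_apply {T : E →L[ℂ] E} {x y : ℕ → E} (h : NuclearRep T x y) (z : E) :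
    Summable fun n => ⟪y n, z⟫ • x n := by
  refine Summable.of_norm_bounded (h.1.mul_left ‖z‖) fun n => ?_
  rw [norm_smul]
  calc ‖⟪y n, z⟫‖ * ‖x n‖ ≤ (‖y n‖ * ‖z‖) * ‖x n‖ := by
        gcongr; exact norm_inner_le_norm _ _
    _ = ‖z‖ * (‖x n‖ * ‖y n‖) := by ring

lemma NuclearRep.inner_apply {T : E →L[ℂ] E} {x y : ℕ → E} (h : NuclearRep T x y) (w z : E) :
    ⟪w, T z⟫ = ∑' n, ⟪y n, z⟫ * ⟪w, x n⟫ := by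
  rw [h.2 z]
  have := (innerSL ℂ w).map_tsum (h.summable_apply z)
  simpa [inner_smul_right] using this

lemma norm_inner_apply_le (A : E →L[ℂ] E) (x y : E) :
    ‖⟪y, A x⟫‖ ≤ ‖A‖ * (‖x‖ * ‖y‖) :=
  calc ‖⟪y, A x⟫‖ ≤ ‖y‖ * ‖A x‖ := norm_inner_le_norm _ _
    _ ≤ ‖y‖ * (‖A‖ * ‖x‖) := by gcongr; exact A.le_opNorm x
    _ = _ := by ring

lemma NuclearRep.summable_norm_inner {T : E →L[ℂ] E} {x y : ℕ → E} (h : NuclearRep T x y)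
    (A : E →L[ℂ] E) : Summable fun n => ‖⟪y n, A (x n)⟫‖ :=
  Summable.of_nonneg_of_le (fun _ => norm_nonneg _) (fun n => norm_inner_apply_le A (x n) (y n))
    (h.1.mul_left ‖A‖)

lemma sum_norm_inner_mul_le {ι : Type*} (b : HilbertBasis ι ℂ E) (x y : E) :
    Summable (fun i => ‖⟪y, b i⟫ * ⟪b i, x⟫‖) ∧
      ∑' i, ‖⟪y, b i⟫ * ⟪b i, x⟫‖ ≤ ‖x‖ * ‖y‖ := by
  have key : ∀ s : Finset ι, ∑ i ∈ s, ‖⟪y, b i⟫ * ⟪b i, x⟫‖ ≤ ‖x‖ * ‖y‖ := by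
    intro s
    have hx := b.orthonormal.sum_inner_products_le (s := s) x
    have hy := b.orthonormal.sum_inner_products_le (s := s) y
    calc ∑ i ∈ s, ‖⟪y, b i⟫ * ⟪b i, x⟫‖ = ∑ i ∈ s, ‖⟪b i, x⟫‖ * ‖⟪b i, y⟫‖ := by
          refine Finset.sum_congr rfl fun i _ => ?_
          rw [norm_mul, norm_inner_symm, mul_comm]
      _ ≤ √(∑ i ∈ s, ‖⟪b i, x⟫‖ ^ 2) * √(∑ i ∈ s, ‖⟪b i, y⟫‖ ^ 2) :=
          Real.sum_mul_le_sqrt_mul_sqrt _ _ _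
      _ ≤ √(‖x‖ ^ 2) * √(‖y‖ ^ 2) := by gcongr
      _ = ‖x‖ * ‖y‖ := by
          rw [Real.sqrt_sq (norm_nonneg _), Real.sqrt_sq (norm_nonneg _)]
  have hs : Summable (fun i => ‖⟪y, b i⟫ * ⟪b i, x⟫‖) :=
    summable_of_sum_le (fun _ => norm_nonneg _) key
  exact ⟨hs, hs.tsum_le_of_sum_le key⟩

lemma NuclearRep.tr_eq {ι : Type*} (b : HilbertBasis ι ℂ E) {T : E →L[ℂ] E} {x y : ℕ → E}
    (h : NuclearRep T x y) : tr b T = ∑' n, ⟪y n, x n⟫ := by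
  unfold tr
  have hsum : Summable (Function.uncurry fun (n : ℕ) (i : ι) => ⟪y n, b i⟫ * ⟪b i, x n⟫) := by
    apply Summable.of_norm
    rw [summable_prod_of_nonneg (fun _ => norm_nonneg _)]
    refine ⟨fun n => (sum_norm_inner_mul_le b (x n) (y n)).1, ?_⟩
    exact Summable.of_nonneg_of_le (fun n => tsum_nonneg fun _ => norm_nonneg _)
      (fun n => (sum_norm_inner_mul_le b (x n) (y n)).2) h.1
  calc ∑' i, ⟪b i, T (b i)⟫ = ∑' i, ∑' n, ⟪y n, b i⟫ * ⟪b i, x n⟫ :=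
        tsum_congr fun i => h.inner_apply _ _
    _ = ∑' n, ∑' i, ⟪y n, b i⟫ * ⟪b i, x n⟫ := hsum.tsum_comm
    _ = ∑' n, ⟪y n, x n⟫ := tsum_congr fun n => b.tsum_inner_mul_inner _ _

lemma NuclearRep.comp_left {T : E →L[ℂ] E} {x y : ℕ → E} (h : NuclearRep T x y)
    (A : E →L[ℂ] E) : NuclearRep (A ∘L T) (fun n => A (x n)) y := by
  refine ⟨Summable.of_nonneg_of_le (fun _ => by positivity) (fun n => ?_) (h.1.mul_left ‖A‖),
    fun z => ?_⟩
  · rw [← mul_assoc]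
    gcongr
    exact A.le_opNorm _
  · rw [ContinuousLinearMap.comp_apply, h.2 z, A.map_tsum (h.summable_apply z)]
    simp

lemma NuclearRep.comp_right {T : E →L[ℂ] E} {x y : ℕ → E} (h : NuclearRep T x y)
    (A : E →L[ℂ] E) : NuclearRep (T ∘L A) x (fun n => adjoint A (y n)) := by
  refine ⟨Summable.of_nonneg_of_le (fun _ => by positivity) (fun n => ?_)
    (h.1.mul_left ‖adjoint A‖), fun z => ?_⟩
  · calc ‖x n‖ * ‖adjoint A (y n)‖ ≤ ‖x n‖ * (‖adjoint A‖ * ‖y n‖) := by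
          gcongr; exact (adjoint A).le_opNorm _
      _ = _ := by ring
  · rw [ContinuousLinearMap.comp_apply, h.2]
    simp [adjoint_inner_left]

lemma nuclearRep_rankOne (u v : E) :
    NuclearRep (rankOne u v) (fun n => if n = 0 then u else 0) (fun n => if n = 0 then v else 0) := by
  constructor
  · exact summable_of_ne_finset_zero (s := {0}) (by intro n hn; simp at hn; simp [hn])
  · intro z
    rw [tsum_eq_single 0]
    · simp
    · intro n hn; simp [hn]

lemma NuclearRep.smul {T : E →L[ℂ] E} {x y : ℕ → E} (h : NuclearRep T x y) (c : ℂ) :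
    NuclearRep (c • T) (fun n => c • x n) y := by
  refine ⟨?_, fun z => ?_⟩
  · simpa [norm_smul, mul_assoc] using h.1.mul_left ‖c‖
  · rw [smul_apply, h.2, ← (h.summable_apply z).tsum_const_smul]
    exact tsum_congr fun n => smul_comm _ _ _

/-- Interleaving of two sequences. -/
def interleave {α : Type*} (u v : ℕ → α) (n : ℕ) : α := if n % 2 = 0 then u (n / 2) else v (n / 2)

@[simp] lemma interleave_even {α : Type*} (u v : ℕ → α) (n : ℕ) :
    interleave u v (2 * n) = u n := by
  simp [interleave]

@[simp] lemma interleave_odd {α : Type*} (u v : ℕ → α) (n : ℕ) :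
    interleave u v (2 * n + 1) = v n := by
  have h1 : (2 * n + 1) / 2 = n := by omega
  have h2 : ¬ (2 * n + 1) % 2 = 0 := by omega
  simp only [interleave, h1, h2, if_false]

lemma NuclearRep.add {S T : E →L[ℂ] E} {x y x' y' : ℕ → E} (h : NuclearRep S x y)
    (h' : NuclearRep T x' y') :
    NuclearRep (S + T) (interleave x x') (interleave y y') := by
  constructor
  · exact (HasSum.even_add_odd (f := fun n => ‖interleave x x' n‖ * ‖interleave y y' n‖)
      (by simpa using h.1.hasSum) (by simpa using h'.1.hasSum)).summable
  · intro z
    refine (HasSum.even_add_odd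
      (f := fun n => ⟪interleave y y' n, z⟫ • interleave x x' n) ?_ ?_).tsum_eq.symm
    · simpa [h.2 z] using (h.summable_apply z).hasSum
    · simpa [h'.2 z] using (h'.summable_apply z).hasSum

lemma IsTraceClass.add {S T : E →L[ℂ] E} (hS : IsTraceClass S) (hT : IsTraceClass T) :
    IsTraceClass (S + T) := by
  obtain ⟨x, y, h⟩ := hS
  obtain ⟨x', y', h'⟩ := hT
  exact ⟨_, _, NuclearRep.add h h'⟩

lemma IsTraceClass.smul {T : E →L[ℂ] E} (hT : IsTraceClass T) (c : ℂ) : IsTraceClass (c • T) := by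
  obtain ⟨x, y, h⟩ := hT
  exact ⟨_, _, NuclearRep.smul h c⟩

lemma IsTraceClass.comp_left {T : E →L[ℂ] E} (hT : IsTraceClass T) (A : E →L[ℂ] E) :
    IsTraceClass (A ∘L T) := by
  obtain ⟨x, y, h⟩ := hT
  exact ⟨_, _, NuclearRep.comp_left h A⟩

lemma IsTraceClass.comp_right {T : E →L[ℂ] E} (hT : IsTraceClass T) (A : E →L[ℂ] E) :
    IsTraceClass (T ∘L A) := by
  obtain ⟨x, y, h⟩ := hT
  exact ⟨_, _, NuclearRep.comp_right h A⟩

lemma isTraceClass_rankOne (u v : E) : IsTraceClass (rankOne u v) :=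
  ⟨_, _, nuclearRep_rankOne u v⟩

lemma isTraceClass_zero : IsTraceClass (0 : E →L[ℂ] E) := by
  simpa using (isTraceClass_rankOne (0 : E) 0).smul 0

lemma isTraceClass_sum {α : Type*} (s : Finset α) {T : α → E →L[ℂ] E}
    (h : ∀ a ∈ s, IsTraceClass (T a)) : IsTraceClass (∑ a ∈ s, T a) :=
  Finset.sum_induction T IsTraceClass (fun _ _ => IsTraceClass.add) isTraceClass_zero h

variable {ι : Type*} (b : HilbertBasis ι ℂ E)

lemma NuclearRep.pairing_eq {T : E →L[ℂ] E} {x y : ℕ → E} (h : NuclearRep T x y)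
    (A : E →L[ℂ] E) : pairing b A T = ∑' n, ⟪y n, A (x n)⟫ :=
  (h.comp_left A).tr_eq b

lemma pairing_comp_right {T : E →L[ℂ] E} (hT : IsTraceClass T) (A B : E →L[ℂ] E) :
    pairing b A (T ∘L B) = pairing b (B ∘L A) T := by
  obtain ⟨x, y, h⟩ := hT
  rw [NuclearRep.pairing_eq b (NuclearRep.comp_right h B), NuclearRep.pairing_eq b h]
  simp [adjoint_inner_left]

lemma pairing_rankOne (A : E →L[ℂ] E) (u v : E) : pairing b A (rankOne u v) = ⟪v, A u⟫ := by
  rw [NuclearRep.pairing_eq b (nuclearRep_rankOne u v), tsum_eq_single 0]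
  · simp
  · intro n hn; simp [hn]

lemma rankOne_pairing {T : E →L[ℂ] E} (hT : IsTraceClass T) (u v : E) :
    pairing b (rankOne u v) T = ⟪v, T u⟫ := by
  obtain ⟨x, y, h⟩ := hT
  rw [NuclearRep.pairing_eq b h, NuclearRep.inner_apply h]
  refine tsum_congr fun n => ?_
  simp [mul_comm]

lemma pairing_add_left {T : E →L[ℂ] E} (hT : IsTraceClass T) (A B : E →L[ℂ] E) :
    pairing b (A + B) T = pairing b A T + pairing b B T := by
  obtain ⟨x, y, h⟩ := hT
  simp only [NuclearRep.pairing_eq b h]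
  rw [← (NuclearRep.summable_norm_inner h A).of_norm.tsum_add
    (NuclearRep.summable_norm_inner h B).of_norm]
  simp

lemma pairing_smul_left {T : E →L[ℂ] E} (hT : IsTraceClass T) (c : ℂ) (A : E →L[ℂ] E) :
    pairing b (c • A) T = c * pairing b A T := by
  obtain ⟨x, y, h⟩ := hT
  simp only [NuclearRep.pairing_eq b h]
  rw [← tsum_mul_left]
  simp

lemma pairing_adjoint_left {T : E →L[ℂ] E} (hT : IsTraceClass T)
    (hsa : ∀ x y, ⟪x, T y⟫ = ⟪T x, y⟫) (A : E →L[ℂ] E) :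
    pairing b (adjoint A) T = starRingEnd ℂ (pairing b A T) := by
  have hT' : adjoint T = T := by
    ext x
    refine ext_inner_left ℂ fun v => ?_
    rw [adjoint_inner_right, hsa]
  have h1 : pairing b A T = tr b (T ∘L A) := by
    have := pairing_comp_right b hT (ContinuousLinearMap.id ℂ E) A
    simpa [pairing] using this.symm
  rw [h1]
  unfold pairing tr
  rw [Complex.conj_tsum]
  refine tsum_congr fun i => ?_
  rw [ContinuousLinearMap.comp_apply, ContinuousLinearMap.comp_apply,
    adjoint_inner_right, hsa, inner_conj_symm]

lemma pairing_smul_right (A T : E →L[ℂ] E) (c : ℂ) :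
    pairing b A (c • T) = c * pairing b A T := by
  unfold pairing tr
  rw [← tsum_mul_left]
  simp

lemma pairing_add_right {S T : E →L[ℂ] E} (hS : IsTraceClass S) (hT : IsTraceClass T)
    (A : E →L[ℂ] E) : pairing b A (S + T) = pairing b A S + pairing b A T := by
  obtain ⟨x, y, h⟩ := hS
  obtain ⟨x', y', h'⟩ := hT
  rw [NuclearRep.pairing_eq b (NuclearRep.add h h'), NuclearRep.pairing_eq b h,
    NuclearRep.pairing_eq b h']
  refine (HasSum.even_add_odd
    (f := fun n => ⟪interleave y y' n, A (interleave x x' n)⟫) ?_ ?_).tsum_eq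
  · simpa using (NuclearRep.summable_norm_inner h A).of_norm.hasSum
  · simpa using (NuclearRep.summable_norm_inner h' A).of_norm.hasSum

lemma pairing_sum_right {α : Type*} (s : Finset α) {T : α → E →L[ℂ] E}
    (hT : ∀ a ∈ s, IsTraceClass (T a)) (A : E →L[ℂ] E) :
    pairing b A (∑ a ∈ s, T a) = ∑ a ∈ s, pairing b A (T a) := by
  classical
  induction s using Finset.induction_on with
  | empty => simp [pairing, tr]
  | insert a s ha ih =>
    rw [Finset.sum_insert ha, Finset.sum_insert ha, pairing_add_right b
      (hT a (by simp)) (isTraceClass_sum _ fun c hc => hT c (by simp [hc])),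
      ih fun c hc => hT c (by simp [hc])]

lemma norm_pairing_le {T : E →L[ℂ] E} (hT : IsTraceClass T) (A : E →L[ℂ] E) :
    ‖pairing b A T‖ ≤ ‖A‖ * traceNorm T := by
  rcases (norm_nonneg A).eq_or_lt with hA | hA
  · have : A = 0 := norm_eq_zero.1 hA.symm
    subst this
    simp [pairing, tr]
  rw [mul_comm, ← div_le_iff₀ hA]
  obtain ⟨x, y, h⟩ := hT
  refine le_csInf ⟨_, x, y, h.1.hasSum, h.2⟩ ?_
  rintro c ⟨x', y', hc, h'⟩
  have hr : NuclearRep T x' y' := ⟨hc.summable, h'⟩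
  rw [div_le_iff₀ hA, NuclearRep.pairing_eq b hr, ← hc.tsum_eq, mul_comm, ← tsum_mul_left]
  exact tsum_of_norm_bounded (hr.1.mul_left ‖A‖).hasSum fun n => norm_inner_apply_le A _ _

lemma pairing_nonneg {T A : E →L[ℂ] E} (hT : IsTraceClass T) (hpos : ∀ x, 0 ≤ ⟪x, T x⟫)
    (hA : A.IsPositive) : 0 ≤ pairing b A T := by
  obtain ⟨S, rfl⟩ := CStarAlgebra.nonneg_iff_eq_star_mul_self.1
    ((ContinuousLinearMap.nonneg_iff_isPositive A).2 hA)
  obtain ⟨x, y, h⟩ := hT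
  have h2 : pairing b (star S * S) T = tr b (S ∘L T ∘L adjoint S) := by
    rw [NuclearRep.pairing_eq b h, ((NuclearRep.comp_right h (adjoint S)).comp_left S).tr_eq b]
    simp [star_eq_adjoint, adjoint_inner_right]
  rw [h2]
  refine tsum_nonneg fun i => ?_
  have := hpos (adjoint S (b i))
  rwa [adjoint_inner_left] at this

end TraceClass

/-! ### The trace norm and polar cones -/

section TraceNorm

variable {E : Type*} [NormedAddCommGroup E] [InnerProductSpace ℂ E] [CompleteSpace E]

lemma bddBelow_traceNorm (T : E →L[ℂ] E) :
    BddBelow {c : ℝ | ∃ x y : ℕ → E, HasSum (fun n => ‖x n‖ * ‖y n‖) c ∧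
      ∀ z, T z = ∑' n, ⟪y n, z⟫ • x n} :=
  ⟨0, by rintro c ⟨x, y, hc, -⟩; exact hc.nonneg fun _ => by positivity⟩

lemma traceNorm_nonneg (T : E →L[ℂ] E) : 0 ≤ traceNorm T :=
  Real.sInf_nonneg (by rintro c ⟨x, y, hc, -⟩; exact hc.nonneg fun _ => by positivity)

lemma NuclearRep.traceNorm_le {T : E →L[ℂ] E} {x y : ℕ → E} (h : NuclearRep T x y) :
    traceNorm T ≤ ∑' n, ‖x n‖ * ‖y n‖ :=
  csInf_le (bddBelow_traceNorm T) ⟨x, y, h.1.hasSum, h.2⟩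

lemma IsTraceClass.exists_lt {T : E →L[ℂ] E} (hT : IsTraceClass T) {ε : ℝ} (hε : 0 < ε) :
    ∃ x y, NuclearRep T x y ∧ ∑' n, ‖x n‖ * ‖y n‖ < traceNorm T + ε := by
  obtain ⟨x, y, h⟩ := hT
  have hne : {c : ℝ | ∃ x y : ℕ → E, HasSum (fun n => ‖x n‖ * ‖y n‖) c ∧
      ∀ z, T z = ∑' n, ⟪y n, z⟫ • x n}.Nonempty := ⟨_, x, y, h.1.hasSum, h.2⟩
  obtain ⟨c, ⟨x, y, hc, h'⟩, hlt⟩ := exists_lt_of_csInf_lt hne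
    (lt_add_of_pos_right (traceNorm T) hε)
  exact ⟨x, y, ⟨hc.summable, h'⟩, by rwa [hc.tsum_eq]⟩

lemma traceNorm_rankOne_le (u v : E) : traceNorm (rankOne u v) ≤ ‖u‖ * ‖v‖ := by
  refine (nuclearRep_rankOne u v).traceNorm_le.trans_eq ?_
  rw [tsum_eq_single 0]
  · simp
  · intro n hn; simp [hn]

lemma traceNorm_zero : traceNorm (0 : E →L[ℂ] E) = 0 := by
  refine le_antisymm ?_ (traceNorm_nonneg _)
  have h : rankOne (0 : E) 0 = 0 := by ext; simp
  simpa [h] using traceNorm_rankOne_le (0 : E) 0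

lemma traceNorm_add_le {S T : E →L[ℂ] E} (hS : IsTraceClass S) (hT : IsTraceClass T) :
    traceNorm (S + T) ≤ traceNorm S + traceNorm T := by
  refine le_of_forall_pos_le_add fun ε hε => ?_
  obtain ⟨x, y, h, hlt⟩ := hS.exists_lt (half_pos hε)
  obtain ⟨x', y', h', hlt'⟩ := hT.exists_lt (half_pos hε)
  refine (h.add h').traceNorm_le.trans ?_
  have : ∑' n, ‖interleave x x' n‖ * ‖interleave y y' n‖ =
      ∑' n, ‖x n‖ * ‖y n‖ + ∑' n, ‖x' n‖ * ‖y' n‖ :=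
    (HasSum.even_add_odd (f := fun n => ‖interleave x x' n‖ * ‖interleave y y' n‖)
      (by simpa using h.1.hasSum) (by simpa using h'.1.hasSum)).tsum_eq
  linarith

lemma traceNorm_smul_le {T : E →L[ℂ] E} (hT : IsTraceClass T) (c : ℂ) :
    traceNorm (c • T) ≤ ‖c‖ * traceNorm T := by
  rcases (norm_nonneg c).eq_or_lt with hc | hc
  · have : c = 0 := norm_eq_zero.1 hc.symm
    simp [this, traceNorm_zero]
  refine le_of_forall_pos_le_add fun ε hε => ?_
  obtain ⟨x, y, h, hlt⟩ := hT.exists_lt (div_pos hε hc)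
  refine (h.smul c).traceNorm_le.trans ?_
  simp only [norm_smul, mul_assoc, tsum_mul_left]
  have := mul_le_mul_of_nonneg_left hlt.le hc.le
  rwa [mul_add, mul_div_cancel₀ _ hc.ne'] at this

variable (E) in
/-- The subspace of trace class operators. -/
def traceClassSubmodule : Submodule ℂ (E →L[ℂ] E) where
  carrier := {T | IsTraceClass T}
  add_mem' := IsTraceClass.add
  zero_mem' := isTraceClass_zero
  smul_mem' c _ h := IsTraceClass.smul h c

variable (E) in
/-- The space of trace class operators, to be equipped with the trace norm. -/
def TraceClassSpace : Type _ := traceClassSubmodule E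

namespace TraceClassSpace

instance : AddCommGroup (TraceClassSpace E) :=
  inferInstanceAs (AddCommGroup (traceClassSubmodule E))

instance : Module ℂ (TraceClassSpace E) :=
  inferInstanceAs (Module ℂ (traceClassSubmodule E))

variable (E) in
/-- The inclusion of the trace class into the bounded operators. -/
def val : TraceClassSpace E →ₗ[ℂ] (E →L[ℂ] E) := (traceClassSubmodule E).subtype

/-- Bundling of a trace class operator. -/
def mk (T : E →L[ℂ] E) (hT : IsTraceClass T) : TraceClassSpace E := ⟨T, hT⟩

@[simp] lemma val_mk (T : E →L[ℂ] E) (hT : IsTraceClass T) : val E (mk T hT) = T := rfl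

lemma val_injective : Function.Injective (val E) := Subtype.val_injective

lemma isTraceClass_val (T : TraceClassSpace E) : IsTraceClass (val E T) := T.2

variable (E) in
/-- The trace norm as a seminorm. -/
def seminorm : Seminorm ℂ (TraceClassSpace E) :=
  Seminorm.ofSMulLE (fun T => traceNorm (val E T)) (by simp [traceNorm_zero])
    (fun S T => by
      rw [map_add]; exact traceNorm_add_le (isTraceClass_val S) (isTraceClass_val T))
    (fun c T => by rw [map_smul]; exact traceNorm_smul_le (isTraceClass_val T) c)

instance : SeminormedAddCommGroup (TraceClassSpace E) :=
  (seminorm E).toAddGroupSeminorm.toSeminormedAddCommGroup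

lemma norm_def (T : TraceClassSpace E) : ‖T‖ = traceNorm (val E T) := rfl

instance : NormedSpace ℂ (TraceClassSpace E) where
  norm_smul_le c T := by
    rw [norm_def, map_smul]; exact traceNorm_smul_le (isTraceClass_val T) c

lemma tendsto_sum_rankOne {T : TraceClassSpace E} {x y : ℕ → E}
    (h : NuclearRep (val E T) x y) :
    Filter.Tendsto (fun N => ∑ n ∈ Finset.range N,
      mk (rankOne (x n) (y n)) (isTraceClass_rankOne _ _)) Filter.atTop (nhds T) := by
  rw [tendsto_iff_norm_sub_tendsto_zero]
  refine squeeze_zero (fun _ => norm_nonneg _) (fun N => ?_)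
    (tendsto_sum_nat_add fun n => ‖x n‖ * ‖y n‖)
  rw [norm_sub_rev, norm_def]
  refine NuclearRep.traceNorm_le (x := fun n => x (n + N)) (y := fun n => y (n + N))
    ⟨(summable_nat_add_iff (f := fun n => ‖x n‖ * ‖y n‖) N).2 h.1, fun z => ?_⟩
  rw [map_sub, sub_apply, h.2 z, ← (h.summable_apply z).sum_add_tsum_nat_add N, map_sum]
  simp

/-- The operator representing a continuous functional on the trace class. -/
lemma exists_pairing_eq {ι : Type*} (b : HilbertBasis ι ℂ E)
    (f : TraceClassSpace E →L[ℂ] ℂ) :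
    ∃ A : E →L[ℂ] E, ∀ T, f T = pairing b A (val E T) := by
  let B : E →L⋆[ℂ] E →L[ℂ] ℂ := LinearMap.mkContinuous₂
    (LinearMap.mk₂'ₛₗ (starRingEnd ℂ) (RingHom.id ℂ)
      (fun y x => f (mk (rankOne x y) (isTraceClass_rankOne _ _)))
      (fun y y' x => by
        rw [← map_add]; congr 1; apply val_injective; ext; simp [add_smul])
      (fun c y x => by
        rw [← map_smul]; congr 1; apply val_injective; ext; simp [smul_smul, mul_comm])
      (fun y x x' => by
        rw [← map_add]; congr 1; apply val_injective; ext; simp)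
      (fun c y x => by
        rw [← map_smul]; congr 1; apply val_injective; ext; simp [smul_comm c]))
    ‖f‖ (fun y x => by
      refine (f.le_opNorm _).trans ?_
      rw [mul_assoc]
      gcongr
      rw [mul_comm]
      exact traceNorm_rankOne_le x y)
  let A := adjoint (InnerProductSpace.continuousLinearMapOfBilin B)
  have hA : ∀ x y, ⟪y, A x⟫ = f (mk (rankOne x y) (isTraceClass_rankOne _ _)) := by
    intro x y
    rw [adjoint_inner_right, InnerProductSpace.continuousLinearMapOfBilin_apply]
    rfl
  refine ⟨A, fun T => ?_⟩
  obtain ⟨x, y, h⟩ := isTraceClass_val T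
  have hr : NuclearRep (val E T) x y := h
  have h1 := (f.continuous.tendsto T).comp (tendsto_sum_rankOne hr)
  have h2 := (hr.summable_norm_inner A).of_norm.hasSum.tendsto_sum_nat
  rw [hr.pairing_eq b]
  refine tendsto_nhds_unique h1 (h2.congr fun N => ?_)
  simp [hA]

end TraceClassSpace

open TraceClassSpace in
/-- Bipolar theorem: the trace-norm closed convex cone generated by the vector states of a set `G`
is the dual cone of the operators with nonnegative quadratic form on `G`. -/
theorem closed_cone_iff_pairing_nonneg {ι : Type*} (b : HilbertBasis ι ℂ E) (G : Set E)
    (hG : ∀ c : ℝ, ∀ x ∈ G, (c : ℂ) • x ∈ G) {T : E →L[ℂ] E} (hT : IsTraceClass T) :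
    (∀ ε : ℝ, 0 < ε → ∃ (n : ℕ) (x : Fin n → E), (∀ i, x i ∈ G) ∧
      traceNorm (T - ∑ i, rankOne (x i) (x i)) < ε) ↔
    ∀ A : E →L[ℂ] E, (∀ x ∈ G, 0 ≤ ⟪x, A x⟫) → 0 ≤ pairing b A T := by
  constructor
  · intro h A hA
    have hcl : IsClosed {z : ℂ | 0 ≤ z} := isClosed_Ici
    refine hcl.closure_subset_iff.2 subset_rfl (Metric.mem_closure_iff.2 fun ε hε => ?_)
    have hpos : 0 < ‖A‖ + 1 := by positivity
    obtain ⟨n, x, hx, hlt⟩ := h (ε / (‖A‖ + 1)) (div_pos hε hpos)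
    have htc : IsTraceClass (∑ i, rankOne (x i) (x i)) :=
      isTraceClass_sum _ fun _ _ => isTraceClass_rankOne _ _
    refine ⟨pairing b A (∑ i, rankOne (x i) (x i)), ?_, ?_⟩
    · rw [pairing_sum_right b _ fun _ _ => isTraceClass_rankOne _ _, Set.mem_ofPred_eq]
      exact Finset.sum_nonneg fun i _ => by rw [pairing_rankOne]; exact hA _ (hx i)
    · have hsub : T - ∑ i, rankOne (x i) (x i) = T + (-1 : ℂ) • ∑ i, rankOne (x i) (x i) := by
        simp [sub_eq_add_neg]
      have htc' : IsTraceClass (T - ∑ i, rankOne (x i) (x i)) := by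
        rw [hsub]; exact hT.add (htc.smul _)
      have : pairing b A T - pairing b A (∑ i, rankOne (x i) (x i)) =
          pairing b A (T - ∑ i, rankOne (x i) (x i)) := by
        rw [hsub, pairing_add_right b hT (htc.smul _), pairing_smul_right]; ring
      rw [dist_eq_norm, this]
      rw [lt_div_iff₀ hpos] at hlt
      refine (norm_pairing_le b htc' A).trans_lt (lt_of_le_of_lt ?_ hlt)
      rw [mul_comm]
      gcongr
      · exact traceNorm_nonneg _
      · linarith
  · intro h
    have hpos : ∀ z, 0 ≤ ⟪z, T z⟫ := fun z => by
      rw [← rankOne_pairing b hT]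
      refine h _ fun x _ => ?_
      rw [rankOne_apply, inner_smul_right, ← inner_conj_symm x z, Complex.mul_conj]
      exact_mod_cast Complex.normSq_nonneg _
    have hsa : ∀ x y, ⟪x, T y⟫ = ⟪T x, y⟫ := by
      have : (T : E →ₗ[ℂ] E).IsSymmetric := by
        rw [LinearMap.isSymmetric_iff_inner_map_self_real]
        intro z
        have h0 : (⟪z, T z⟫).im = 0 := (Complex.nonneg_iff.1 (hpos z)).2.symm
        rw [Complex.conj_eq_iff_im, ContinuousLinearMap.coe_coe, ← inner_conj_symm, Complex.conj_im,
          h0, neg_zero]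
      exact fun x y => (this x y).symm
    let C : Set (TraceClassSpace E) := {S | ∃ (n : ℕ) (x : Fin n → E), (∀ i, x i ∈ G) ∧
      val E S = ∑ i, rankOne (x i) (x i)}
    have hCadd : ∀ S ∈ C, ∀ S' ∈ C, S + S' ∈ C := by
      rintro S ⟨n, x, hx, hS⟩ S' ⟨n', x', hx', hS'⟩
      refine ⟨n + n', Fin.append x x', fun i => ?_, ?_⟩
      · refine Fin.addCases (fun i => ?_) (fun i => ?_) i
        · simpa using hx i
        · simpa using hx' i
      · rw [map_add, hS, hS', Fin.sum_univ_add]; simp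
    have hCsmul : ∀ c : ℝ, 0 ≤ c → ∀ S ∈ C, c • S ∈ C := by
      rintro c hc S ⟨n, x, hx, hS⟩
      refine ⟨n, fun i => (√c : ℂ) • x i, fun i => hG _ _ (hx i), ?_⟩
      have : val E (c • S) = (c : ℂ) • val E S := by
        rw [← map_smul]; rfl
      rw [this, hS, Finset.smul_sum]
      refine Finset.sum_congr rfl fun i _ => ?_
      ext z
      have hcc : (c : ℂ) = (√c : ℂ) * (√c : ℂ) := by
        rw [← Complex.ofReal_mul, Real.mul_self_sqrt hc]
      simp only [smul_apply, rankOne_apply, inner_smul_left, Complex.conj_ofReal, smul_smul]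
      rw [hcc]; ring_nf
    have hC0 : (0 : TraceClassSpace E) ∈ C := ⟨0, Fin.elim0, fun i => i.elim0, by simp⟩
    have hconv : Convex ℝ C := fun S hS S' hS' a a' ha ha' _ =>
      hCadd _ (hCsmul a ha _ hS) _ (hCsmul a' ha' _ hS')
    by_cases hmem : mk T hT ∈ closure C
    · intro ε hε
      obtain ⟨S, ⟨n, x, hx, hS⟩, hlt⟩ := Metric.mem_closure_iff.1 hmem ε hε
      refine ⟨n, x, hx, ?_⟩
      rw [dist_eq_norm, TraceClassSpace.norm_def, map_sub, hS] at hlt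
      exact hlt
    · exfalso
      obtain ⟨f, u, hu, hf⟩ := RCLike.geometric_hahn_banach_point_closed (𝕜 := ℂ) hconv.closure
        isClosed_closure hmem
      have hu0 : u < 0 := by simpa using hf 0 (subset_closure hC0)
      have hfC : ∀ S ∈ C, 0 ≤ (f S).re := by
        intro S hS
        by_contra! hneg
        have := hf _ (subset_closure (hCsmul (u / (f S).re)
          (div_nonneg_of_nonpos hu0.le hneg.le) S hS))
        have h2 : f ((u / (f S).re) • S) = ((u / (f S).re : ℝ) : ℂ) * f S := by
          rw [← smul_eq_mul, ← map_smul]; rfl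
        rw [h2] at this
        simp only [RCLike.re_to_complex, Complex.re_ofReal_mul] at this
        rw [div_mul_cancel₀ _ hneg.ne] at this
        exact lt_irrefl _ this
      obtain ⟨A, hA⟩ := exists_pairing_eq b f
      have hAG : ∀ x ∈ G, 0 ≤ (⟪x, A x⟫).re := by
        intro x hx
        have := hfC (mk (rankOne x x) (isTraceClass_rankOne _ _)) ⟨1, fun _ => x, fun _ => hx, by simp⟩
        rwa [hA, val_mk, pairing_rankOne] at this
      have hpair := h (A + adjoint A) fun x hx => by
        rw [add_apply, inner_add_right, adjoint_inner_right, ← inner_conj_symm (A x) x,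
          Complex.add_conj]
        exact_mod_cast mul_nonneg zero_le_two (hAG x hx)
      rw [pairing_add_left b hT, pairing_adjoint_left b hT hsa, Complex.add_conj] at hpair
      have h3 : 0 ≤ 2 * (pairing b A T).re := by exact_mod_cast hpair
      rw [hA, val_mk] at hu
      simp only [RCLike.re_to_complex] at hu
      linarith

end TraceNorm

/-! ### Hilbert–Schmidt operators -/

section NormalPair

variable {E : Type*} [NormedAddCommGroup E] [InnerProductSpace ℂ E] [CompleteSpace E]
  {ι : Type*} {b : HilbertBasis ι ℂ E} {Φ Φst : (E →L[ℂ] E) →ₗ[ℂ] (E →L[ℂ] E)}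

lemma IsNormalPair.isTraceClass (h : IsNormalPair b Φ Φst) (x y : E) :
    IsTraceClass (Φst (rankOne x y)) :=
  h.1 _ (isTraceClass_rankOne x y)

lemma IsNormalPair.pairing_predual (h : IsNormalPair b Φ Φst) (A : E →L[ℂ] E) (x y : E) :
    pairing b A (Φst (rankOne x y)) = ⟪y, Φ A x⟫ := by
  rw [← h.2 _ _ (isTraceClass_rankOne x y), pairing_rankOne]

lemma IsNormalPair.inner_predual (h : IsNormalPair b Φ Φst) (x u v : E) :
    ⟪v, Φst (rankOne x x) u⟫ = ⟪x, Φ (rankOne u v) x⟫ := by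
  rw [← h.pairing_predual, rankOne_pairing b (h.isTraceClass x x)]

lemma continuous_pairing {T : E →L[ℂ] E} (hT : IsTraceClass T) :
    Continuous fun A => pairing b A T := by
  have : (fun A => pairing b A T) = (LinearMap.mkContinuous
      ({ toFun := fun A => pairing b A T
         map_add' := pairing_add_left b hT
         map_smul' := fun c A => pairing_smul_left b hT c A } : (E →L[ℂ] E) →ₗ[ℂ] ℂ)
      (traceNorm T) fun A => by
        rw [mul_comm]; exact norm_pairing_le b hT A) := rfl
  rw [this]
  exact ContinuousLinearMap.continuous _

lemma IsNormalPair.continuous (h : IsNormalPair b Φ Φst) : Continuous Φ := by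
  refine Φ.continuous_of_seq_closed_graph fun u A B hu hB => ?_
  ext x
  refine ext_inner_left ℂ fun y => ?_
  have h1 := ((continuous_pairing (b := b) (h.isTraceClass x y)).tendsto A).comp hu
  rw [h.pairing_predual] at h1
  have hc : Continuous fun T : E →L[ℂ] E => ⟪y, T x⟫ := by fun_prop
  have h2 : Filter.Tendsto (fun n => ⟪y, Φ (u n) x⟫) Filter.atTop (nhds ⟪y, B x⟫) :=
    (hc.tendsto B).comp hB
  exact tendsto_nhds_unique h2
    (h1.congr fun n => by rw [Function.comp_apply, h.pairing_predual])

lemma isPositive_of_inner_nonneg {T : E →L[ℂ] E} (h : ∀ x, 0 ≤ ⟪x, T x⟫) : T.IsPositive := by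
  rw [isPositive_iff_complex]
  intro x
  obtain ⟨h1, h2⟩ := Complex.nonneg_iff.1 (h x)
  have h3 : ⟪T x, x⟫ = (starRingEnd ℂ) ⟪x, T x⟫ := (inner_conj_symm _ _).symm
  have h4 : ⟪T x, x⟫.re = ⟪x, T x⟫.re := by rw [h3, Complex.conj_re]
  have h5 : ⟪T x, x⟫.im = 0 := by rw [h3, Complex.conj_im, ← h2, neg_zero]
  refine ⟨Complex.ext (by simp) (by simp [h5]), ?_⟩
  exact h1.trans_eq h4.symm

lemma dense_finite_sums {α β : Type*} [SMul ℂ α] (g : α → β → E)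
    (hsmul : ∀ (c : ℂ) a b, c • g a b = g (c • a) b)
    (htot : ∀ x, (∀ a b, ⟪g a b, x⟫ = 0) → x = 0) :
    Dense {y : E | ∃ (n : ℕ) (u : Fin n → α) (v : Fin n → β), ∑ i, g (u i) (v i) = y} := by
  have hspan : (Submodule.span ℂ (Set.range fun p : α × β => g p.1 p.2))ᗮ = ⊥ := by
    rw [Submodule.eq_bot_iff]
    intro x hx
    exact htot x fun a b => hx _ (Submodule.subset_span ⟨(a, b), rfl⟩)
  have hd := Submodule.dense_iff_topologicalClosure_eq_top.2
    ((Submodule.topologicalClosure_eq_top_iff).2 hspan)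
  refine hd.mono fun y hy => ?_
  obtain ⟨n, c, w, rfl⟩ := Submodule.mem_span_set'.1 hy
  choose p hp using fun i => (w i).2
  refine ⟨n, fun i => c i • (p i).1, fun i => (p i).2, ?_⟩
  refine Finset.sum_congr rfl fun i _ => ?_
  rw [← hsmul, ← hp i]

lemma forall_nonneg_of_dense {G : Set E} (hG : Dense G) {A : E →L[ℂ] E}
    (h : ∀ y ∈ G, 0 ≤ ⟪y, A y⟫) (x : E) : 0 ≤ ⟪x, A x⟫ := by
  have hcl : IsClosed {y : E | 0 ≤ ⟪y, A y⟫} := by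
    have hc : Continuous fun y : E => ⟪y, A y⟫ := by fun_prop
    exact isClosed_Ici.preimage hc
  exact hcl.closure_subset_iff.2 h (hG x)

end NormalPair

section Rank

variable {K : Type*} [NormedAddCommGroup K] [InnerProductSpace ℂ K] {k : ℕ}

lemma rankLE_of_forall_mem_span {T : K →L[ℂ] K} (h : Fin k → K)
    (hT : ∀ v, T v ∈ Submodule.span ℂ (Set.range h)) : rankLE T k := by
  unfold rankLE
  have h1 : LinearMap.range (T : K →ₗ[ℂ] K) ≤ Submodule.span ℂ (Set.range h) := by
    rintro _ ⟨v, rfl⟩; exact hT v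
  refine (Submodule.rank_mono h1).trans ((rank_span_le _).trans ?_)
  have h2 := Cardinal.mk_range_le_lift (f := h)
  simpa using h2

lemma rankLE.exists_span {T : K →L[ℂ] K} (hT : rankLE T k) :
    ∃ h : Fin k → K, ∀ v, T v ∈ Submodule.span ℂ (Set.range h) := by
  set R := LinearMap.range (T : K →ₗ[ℂ] K)
  have : Module.Finite ℂ R := Module.rank_lt_aleph0_iff.1 (hT.trans_lt (Cardinal.natCast_lt_aleph0))
  have hk : Module.finrank ℂ R ≤ k := by
    have h1 := hT
    unfold rankLE at h1
    rw [← Module.finrank_eq_rank] at h1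
    exact_mod_cast h1
  let B := Module.finBasis ℂ R
  refine ⟨fun i => if hi : (i : ℕ) < Module.finrank ℂ R then (B ⟨i, hi⟩ : K) else 0, fun v => ?_⟩
  have hv : T v = ∑ j, B.repr ⟨T v, LinearMap.mem_range_self _ v⟩ j • (B j : K) := by
    have h1 := congrArg Subtype.val (B.sum_repr ⟨T v, LinearMap.mem_range_self _ v⟩)
    rw [Submodule.coe_sum] at h1
    exact h1.symm
  rw [hv]
  refine Submodule.sum_mem _ fun j _ => Submodule.smul_mem _ _ (Submodule.subset_span ?_)
  exact ⟨⟨j, j.2.trans_le hk⟩, by simp⟩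

lemma rankLE.comp_right {T : K →L[ℂ] K} (hT : rankLE T k) (S : K →L[ℂ] K) :
    rankLE (T ∘L S) k := by
  obtain ⟨h, hh⟩ := hT.exists_span
  exact rankLE_of_forall_mem_span h fun v => hh _

lemma rankLE.comp_left {T : K →L[ℂ] K} (hT : rankLE T k) (S : K →L[ℂ] K) :
    rankLE (S ∘L T) k := by
  obtain ⟨h, hh⟩ := hT.exists_span
  refine rankLE_of_forall_mem_span (fun i => S (h i)) fun v => ?_
  have := Submodule.mem_map_of_mem (f := (S : K →ₗ[ℂ] K)) (hh v)
  rwa [Submodule.map_span, ← Set.range_comp] at this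

lemma rankLE.smul {T : K →L[ℂ] K} (hT : rankLE T k) (c : ℂ) : rankLE (c • T) k := by
  obtain ⟨h, hh⟩ := hT.exists_span
  exact rankLE_of_forall_mem_span h fun v => Submodule.smul_mem _ _ (hh v)

end Rank

namespace HSModel

variable {K : Type*} [NormedAddCommGroup K] [InnerProductSpace ℂ K] [CompleteSpace K]
  {H : Type*} [NormedAddCommGroup H] [InnerProductSpace ℂ H] [CompleteSpace H]
  {ι : Type*} {e : HilbertBasis ι ℂ K} (m : HSModel e H)

lemma isHS_rankOne (e : HilbertBasis ι ℂ K) (u v : K) : IsHS e (rankOne u v) := by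
  unfold IsHS
  refine ((sum_norm_inner_mul_le e v v).1.mul_right (‖u‖ ^ 2)).congr fun i => ?_
  rw [rankOne_apply, norm_smul, norm_mul, norm_inner_symm (e i) v]
  ring

/-- The vector of `H` corresponding to `u ⊠ v`. -/
def vec (u v : K) : H := ((m.mem_range _).1 (isHS_rankOne e u v)).choose

@[simp] lemma toOp_vec (u v : K) : m.toOp (m.vec u v) = rankOne u v :=
  ((m.mem_range _).1 (isHS_rankOne e u v)).choose_spec

lemma inner_vec_left (u v : K) (x : H) : ⟪m.vec u v, x⟫ = ⟪u, m.toOp x v⟫ := by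
  rw [m.inner_eq, toOp_vec, ← adjoint_inner_left, ← e.tsum_inner_mul_inner]
  refine tsum_congr fun i => ?_
  rw [rankOne_apply, inner_smul_left, inner_conj_symm, adjoint_inner_left, mul_comm]

lemma inner_vec_right (u v : K) (x : H) : ⟪x, m.vec u v⟫ = ⟪m.toOp x v, u⟫ := by
  rw [← inner_conj_symm, inner_vec_left, inner_conj_symm]

lemma ext_vec {x y : H} (h : ∀ u v, ⟪m.vec u v, x⟫ = ⟪m.vec u v, y⟫) : x = y := by
  apply m.inj
  ext v
  refine ext_inner_left ℂ fun u => ?_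
  rw [← m.inner_vec_left, ← m.inner_vec_left, h]

lemma ext_vec_op {S T : H →L[ℂ] H}
    (h : ∀ u v u' v', ⟪m.vec u' v', S (m.vec u v)⟫ = ⟪m.vec u' v', T (m.vec u v)⟫) : S = T := by
  have h1 : ∀ u v, S (m.vec u v) = T (m.vec u v) := fun u v => m.ext_vec fun u' v' => h u v u' v'
  have h2 : adjoint S = adjoint T := by
    ext x
    refine m.ext_vec fun u v => ?_
    rw [adjoint_inner_right, adjoint_inner_right, h1]
  exact (adjoint : (H →L[ℂ] H) ≃ₗᵢ⋆[ℂ] (H →L[ℂ] H)).injective h2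

lemma smul_vec (c : ℂ) (u v : K) : c • m.vec u v = m.vec (c • u) v := by
  apply m.inj; ext z; simp [smul_comm c]

lemma Lmul_vec (a : K →L[ℂ] K) (u v : K) : m.Lmul a (m.vec u v) = m.vec (a u) v := by
  apply m.inj; ext z; simp [m.Lmul_eq]

lemma Rmul_vec (a : K →L[ℂ] K) (u v : K) : m.Rmul a (m.vec u v) = m.vec u (adjoint a v) := by
  apply m.inj; ext z; simp [m.Rmul_eq, adjoint_inner_left]

lemma adjoint_Lmul (a : K →L[ℂ] K) : adjoint (m.Lmul a) = m.Lmul (adjoint a) := by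
  refine m.ext_vec_op fun u v u' v' => ?_
  rw [adjoint_inner_right, Lmul_vec, Lmul_vec, inner_vec_left, inner_vec_left]
  simp [adjoint_inner_right]

lemma adjoint_Rmul (a : K →L[ℂ] K) : adjoint (m.Rmul a) = m.Rmul (adjoint a) := by
  refine m.ext_vec_op fun u v u' v' => ?_
  rw [adjoint_inner_right, Rmul_vec, Rmul_vec, inner_vec_left, inner_vec_left]
  simp [adjoint_inner_right]

lemma toOp_Rmul_rankOne_Lmul (v' v : K) (Y : K →L[ℂ] K) (x : H) :
    (m.Rmul (rankOne v' v) ∘L m.Lmul Y) x = m.vec (Y (m.toOp x v')) v := by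
  apply m.inj; ext z; simp [m.Rmul_eq, m.Lmul_eq]

lemma inner_Rmul_rankOne_Lmul (v' v : K) (Y : K →L[ℂ] K) (x : H) :
    ⟪x, (m.Rmul (rankOne v' v) ∘L m.Lmul Y) x⟫ = ⟪m.toOp x v, Y (m.toOp x v')⟫ := by
  rw [toOp_Rmul_rankOne_Lmul, inner_vec_right]

lemma rankOne_vec (u v u' v' : K) : rankOne (m.vec u v) (m.vec u' v') =
    m.Rmul (rankOne v' v) ∘L m.Lmul (rankOne u u') := by
  ext x
  rw [toOp_Rmul_rankOne_Lmul, rankOne_apply, rankOne_apply, ← smul_vec, inner_vec_left]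

lemma norm_sq_eq (x : H) : HasSum (fun i => ‖m.toOp x (e i)‖ ^ 2) (‖x‖ ^ 2) := by
  have hs : Summable fun i => ‖m.toOp x (e i)‖ ^ 2 := (m.mem_range _).2 ⟨x, rfl⟩
  have h1 : ((‖x‖ ^ 2 : ℝ) : ℂ) = ((∑' i, ‖m.toOp x (e i)‖ ^ 2 : ℝ) : ℂ) := by
    rw [Complex.ofReal_tsum]
    have := m.inner_eq x x
    rw [inner_self_eq_norm_sq_to_K] at this
    push_cast
    rw [show (‖x‖ : ℂ) ^ 2 = ((‖x‖ : ℝ) : ℂ) ^ 2 from rfl]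
    refine this.trans (tsum_congr fun i => ?_)
    rw [inner_self_eq_norm_sq_to_K]; rfl
  rw [Complex.ofReal_inj.1 h1]
  exact hs.hasSum

lemma dense_sum_vec :
    Dense {y : H | ∃ (n : ℕ) (u v : Fin n → K), ∑ i, m.vec (u i) (v i) = y} :=
  dense_finite_sums m.vec m.smul_vec fun x hx => m.ext_vec fun u v => by rw [hx, inner_zero_right]

end HSModel

/-! ### Extensions of maps on `B(K)` to `B(H)` -/

section Extension

variable {K : Type*} [NormedAddCommGroup K] [InnerProductSpace ℂ K] [CompleteSpace K]
  {H : Type*} [NormedAddCommGroup H] [InnerProductSpace ℂ H] [CompleteSpace H]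
  {ι ιH : Type*} {e : HilbertBasis ι ℂ K} {bH : HilbertBasis ιH ℂ H} {m : HSModel e H}
  {φ ψ : (K →L[ℂ] K) →ₗ[ℂ] (K →L[ℂ] K)} {Φ Φst Ψ : (H →L[ℂ] H) →ₗ[ℂ] (H →L[ℂ] H)} {k : ℕ}

lemma inner_predual_vec (hext : HSExt m φ Φ) (hnp : IsNormalPair bH Φ Φst) (x : H)
    (u v u' v' : K) : ⟪m.vec u' v', Φst (rankOne x x) (m.vec u v)⟫ =
      ⟪m.toOp x v, φ (rankOne u u') (m.toOp x v')⟫ := by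
  rw [hnp.inner_predual, m.rankOne_vec, hext, m.inner_Rmul_rankOne_Lmul]

lemma predual_rankOne_Rmul (hext : HSExt m φ Φ) (hnp : IsNormalPair bH Φ Φst)
    (a : K →L[ℂ] K) (x : H) : Φst (rankOne (m.Rmul a x) (m.Rmul a x)) =
      m.Rmul a ∘L (Φst (rankOne x x) ∘L adjoint (m.Rmul a)) := by
  refine m.ext_vec_op fun u v u' v' => ?_
  rw [inner_predual_vec hext hnp, comp_apply, comp_apply,
    ← adjoint_inner_left (m.Rmul a) _ (m.vec u' v'), m.adjoint_Rmul,
    m.Rmul_vec, m.Rmul_vec, adjoint_adjoint, inner_predual_vec hext hnp, m.Rmul_eq]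
  rfl

lemma inner_Rmul_map (hext : HSExt m φ Φ) (hnp : IsNormalPair bH Φ Φst)
    (a : K →L[ℂ] K) (x : H) (A : H →L[ℂ] H) : ⟪m.Rmul a x, Φ A (m.Rmul a x)⟫ =
      pairing bH (adjoint (m.Rmul a) ∘L A ∘L m.Rmul a) (Φst (rankOne x x)) := by
  rw [← hnp.pairing_predual, predual_rankOne_Rmul hext hnp,
    ← pairing_comp_right bH (hnp.isTraceClass x x)]
  rfl

/-- `A` is positive on the Hilbert–Schmidt operators of rank at most `k`. -/
def BlockPos (m : HSModel e H) (k : ℕ) (A : H →L[ℂ] H) : Prop :=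
  ∀ x, rankLE (m.toOp x) k → 0 ≤ ⟪x, A x⟫

lemma mem_schmidtCone_iff (bH : HilbertBasis ιH ℂ H) {T : H →L[ℂ] H} (hT : IsTraceClass T) :
    T ∈ SchmidtCone m k ↔ ∀ A, BlockPos m k A → 0 ≤ pairing bH A T :=
  closed_cone_iff_pairing_nonneg bH {x | rankLE (m.toOp x) k}
    (fun c x hx => by
      simp only [Set.mem_ofPred_eq, map_smul] at hx ⊢
      exact hx.smul _) hT

lemma sum_inner_smul_matrix {n N : ℕ} (c : Fin n → Fin N → ℂ) (X : Fin n → Fin n → (K →L[ℂ] K))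
    (w : Fin N → K) :
    ∑ s, ∑ t, ⟪w s, (∑ l, ∑ j, (starRingEnd ℂ (c l s) * c j t) • X l j) (w t)⟫ =
      ∑ l, ∑ j, ⟪∑ s, c l s • w s, X l j (∑ t, c j t • w t)⟫ := by
  simp only [sum_apply, smul_apply, map_sum, map_smul, inner_sum, sum_inner, inner_smul_left,
    inner_smul_right]
  rw [Finset.sum_congr rfl fun s _ => Finset.sum_comm, Finset.sum_comm]
  refine Finset.sum_congr rfl fun l _ => ?_
  rw [Finset.sum_congr rfl fun s _ => Finset.sum_comm, Finset.sum_comm]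
  refine Finset.sum_congr rfl fun j _ => Finset.sum_comm.trans ?_
  refine Finset.sum_congr rfl fun t _ => ?_
  rw [Finset.mul_sum]
  refine Finset.sum_congr rfl fun s _ => ?_
  ring

lemma kPos.sum_inner_nonneg (hψ : kPos k ψ) {x : K →L[ℂ] K} (hx : rankLE x k) {n : ℕ}
    {X : Fin n → Fin n → (K →L[ℂ] K)} (hX : MatPos X) (v : Fin n → K) :
    0 ≤ ∑ l, ∑ j, ⟪x (v l), ψ (X l j) (x (v j))⟫ := by
  obtain ⟨h, hh⟩ := hx.exists_span
  choose c hc using fun l => (Submodule.mem_span_range_iff_exists_fun ℂ).1 (hh (v l))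
  have h1 := hψ (fun s t => ∑ l, ∑ j, (starRingEnd ℂ (c l s) * c j t) • X l j) (fun w => by
    rw [sum_inner_smul_matrix]
    exact hX _) h
  simp only [map_sum, map_smul] at h1
  rw [sum_inner_smul_matrix c (fun l j => ψ (X l j))] at h1
  simpa only [hc] using h1

lemma matPos_rankOne {n : ℕ} (u : Fin n → K) : MatPos fun i j => rankOne (u i) (u j) := by
  intro v
  have : ∑ i, ∑ j, ⟪v i, rankOne (u i) (u j) (v j)⟫ =
      starRingEnd ℂ (∑ i, ⟪u i, v i⟫) * ∑ i, ⟪u i, v i⟫ := by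
    rw [map_sum, Finset.sum_mul_sum]
    refine Finset.sum_congr rfl fun i _ => Finset.sum_congr rfl fun j _ => ?_
    rw [rankOne_apply, inner_smul_right, inner_conj_symm, mul_comm]
  rw [this]
  exact star_mul_self_nonneg _

lemma rankOne_sum_sum {α : Type*} (s : Finset α) (z : α → H) :
    rankOne (∑ i ∈ s, z i) (∑ i ∈ s, z i) = ∑ i ∈ s, ∑ j ∈ s, rankOne (z i) (z j) := by
  ext w
  simp only [rankOne_apply, sum_inner, sum_apply, Finset.sum_smul, Finset.smul_sum]

lemma continuous_rankOne_self : Continuous fun z : H => rankOne z z := by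
  have : (fun z : H => rankOne z z) = fun z => smulRightL ℂ H H (innerSL ℂ z) z := rfl
  rw [this]
  fun_prop

lemma inner_map_rankOne_nonneg (hext : HSExt m ψ Ψ) (hc : Continuous Ψ) (x : H)
    (hpos : ∀ (n : ℕ) (u v : Fin n → K),
      0 ≤ ∑ i, ∑ j, ⟪m.toOp x (v i), ψ (rankOne (u i) (u j)) (m.toOp x (v j))⟫) (z : H) :
    0 ≤ ⟪x, Ψ (rankOne z z) x⟫ := by
  have hcl : IsClosed {z : H | 0 ≤ ⟪x, Ψ (rankOne z z) x⟫} := by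
    have h1 : Continuous fun z : H => ⟪x, Ψ (rankOne z z) x⟫ := by
      have h2 : Continuous fun T : H →L[ℂ] H => ⟪x, T x⟫ := by fun_prop
      exact h2.comp (hc.comp continuous_rankOne_self)
    exact isClosed_Ici.preimage h1
  refine hcl.closure_subset_iff.2 ?_ (m.dense_sum_vec z)
  rintro _ ⟨n, u, v, rfl⟩
  refine (hpos n u v).trans_eq ?_
  rw [rankOne_sum_sum]
  simp only [map_sum, sum_apply, inner_sum, m.rankOne_vec, hext _ _, m.inner_Rmul_rankOne_Lmul]

lemma kPos.blockPos_map (hψ : kPos k ψ) (hext : HSExt m ψ Ψ) (hc : Continuous Ψ) (z : H) :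
    BlockPos m k (Ψ (rankOne z z)) := fun x hx =>
  inner_map_rankOne_nonneg hext hc x
    (fun _ u v => hψ.sum_inner_nonneg hx (matPos_rankOne u) v) z

lemma HSExt.comp (hφ : HSExt m φ Φ) (hψ : HSExt m ψ Ψ) : HSExt m (φ ∘ₗ ψ) (Φ ∘ₗ Ψ) := by
  intro a x
  rw [LinearMap.comp_apply, hψ, hφ, LinearMap.comp_apply]

end Extension

/-! ### Elementary operators -/

section Elementary

variable {E : Type*} [NormedAddCommGroup E] [InnerProductSpace ℂ E] [CompleteSpace E]
  {α : Type*} [Fintype α]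

/-- The elementary operator `X ↦ ∑ᵢ Bᵢ X Cᵢ`. -/
def elementary (B C : α → E →L[ℂ] E) : (E →L[ℂ] E) →ₗ[ℂ] (E →L[ℂ] E) where
  toFun X := ∑ a, B a ∘L X ∘L C a
  map_add' X Y := by simp [Finset.sum_add_distrib]
  map_smul' c X := by simp [Finset.smul_sum]

lemma elementary_apply (B C : α → E →L[ℂ] E) (X : E →L[ℂ] E) :
    elementary B C X = ∑ a, B a ∘L X ∘L C a := rfl

lemma pairing_sum_left {ι : Type*} (b : HilbertBasis ι ℂ E) (s : Finset α) (A : α → E →L[ℂ] E)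
    {T : E →L[ℂ] E} (hT : IsTraceClass T) :
    pairing b (∑ a ∈ s, A a) T = ∑ a ∈ s, pairing b (A a) T :=
  map_sum ({ toFun := fun A => pairing b A T
             map_add' := pairing_add_left b hT
             map_smul' := fun c A => pairing_smul_left b hT c A } : (E →L[ℂ] E) →ₗ[ℂ] ℂ) A s

lemma isNormalPair_elementary {ι : Type*} (b : HilbertBasis ι ℂ E) (B C : α → E →L[ℂ] E) :
    IsNormalPair b (elementary B C) (elementary C B) := by
  refine ⟨fun T hT => isTraceClass_sum _ fun a _ => (hT.comp_right _).comp_left _,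
    fun A T hT => ?_⟩
  rw [elementary_apply, elementary_apply, pairing_sum_left b _ _ hT,
    pairing_sum_right b _ fun a _ => (hT.comp_right _).comp_left _]
  refine Finset.sum_congr rfl fun a _ => ?_
  exact (pairing_comp_right b hT (A ∘L C a) (B a)).symm

lemma sqrt_sum_norm_sq_le {n : ℕ} (A : E →L[ℂ] E) (v : Fin n → E) :
    Real.sqrt (∑ i, ‖A (v i)‖ ^ 2) ≤ ‖A‖ * Real.sqrt (∑ i, ‖v i‖ ^ 2) := by
  rw [← Real.sqrt_sq (norm_nonneg A), ← Real.sqrt_mul (sq_nonneg _), Finset.mul_sum]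
  refine Real.sqrt_le_sqrt (Finset.sum_le_sum fun i _ => ?_)
  rw [← mul_pow]
  exact pow_le_pow_left₀ (norm_nonneg _) (A.le_opNorm _) 2

lemma isCBFullK_elementary (B C : α → E →L[ℂ] E) : IsCBFullK (elementary B C) := by
  refine ⟨∑ a, ‖B a‖ * ‖C a‖, by positivity, fun n A hA v w => ?_⟩
  have h1 : ∑ i, ∑ j, ⟪w i, elementary B C (A i j) (v j)⟫ =
      ∑ a, ∑ i, ∑ j, ⟪adjoint (B a) (w i), A i j (C a (v j))⟫ := by
    simp only [elementary_apply, sum_apply, inner_sum, adjoint_inner_left, comp_apply]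
    rw [Finset.sum_congr rfl fun i _ => Finset.sum_comm, Finset.sum_comm]
  rw [h1, Finset.sum_mul, Finset.sum_mul]
  refine (norm_sum_le _ _).trans (Finset.sum_le_sum fun a _ => ?_)
  refine (hA (fun j => C a (v j)) fun i => adjoint (B a) (w i)).trans ?_
  have h2 := sqrt_sum_norm_sq_le (adjoint (B a)) w
  rw [LinearIsometryEquiv.norm_map] at h2
  calc _ ≤ 1 * (‖C a‖ * Real.sqrt (∑ i, ‖v i‖ ^ 2)) * (‖B a‖ * Real.sqrt (∑ i, ‖w i‖ ^ 2)) := by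
        gcongr
        exact sqrt_sum_norm_sq_le _ _
    _ = _ := by ring

variable {H : Type*} [NormedAddCommGroup H] [InnerProductSpace ℂ H] [CompleteSpace H]
  {ι : Type*} {e : HilbertBasis ι ℂ E}

lemma normalCB_elementary (B C : α → E →L[ℂ] E) : NormalCB e (elementary B C) :=
  ⟨⟨_, isNormalPair_elementary e B C⟩, isCBFullK_elementary B C⟩

lemma hsExt_elementary (m : HSModel e H) (B C : α → E →L[ℂ] E) :
    HSExt m (elementary B C) (elementary (fun a => m.Lmul (B a)) fun a => m.Lmul (C a)) := by
  intro a x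
  ext y
  apply m.inj
  ext v
  simp [elementary_apply, m.Lmul_eq, m.Rmul_eq]

end Elementary

/-! ### Superpositive maps -/

section Superpositive

variable {K : Type*} [NormedAddCommGroup K] [InnerProductSpace ℂ K] [CompleteSpace K]
  {H : Type*} [NormedAddCommGroup H] [InnerProductSpace ℂ H] [CompleteSpace H]
  {ι ιH : Type*} {e : HilbertBasis ι ℂ K} {bH : HilbertBasis ιH ℂ H} {m : HSModel e H}
  {φ ψ : (K →L[ℂ] K) →ₗ[ℂ] (K →L[ℂ] K)} {Φ Φst Ψ Ψst : (H →L[ℂ] H) →ₗ[ℂ] (H →L[ℂ] H)}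
  {k : ℕ} {x0 : H}

lemma predual_rankOne_of_sum_Ad {n : ℕ} {V : Fin n → (K →L[ℂ] K)}
    (hψ : ∀ x, ψ x = ∑ i, star (V i) * x * V i) (hext : HSExt m ψ Ψ)
    (hnp : IsNormalPair bH Ψ Ψst) (x : H) :
    Ψst (rankOne x x) = ∑ i, rankOne (m.Lmul (V i) x) (m.Lmul (V i) x) := by
  refine m.ext_vec_op fun u v u' v' => ?_
  rw [inner_predual_vec hext hnp, hψ]
  simp only [sum_apply, inner_sum]
  refine Finset.sum_congr rfl fun i _ => ?_
  rw [mul_def, mul_def, comp_apply, comp_apply, star_eq_adjoint, adjoint_inner_right,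
    rankOne_apply, rankOne_apply, inner_smul_right, inner_smul_right, m.inner_vec_left,
    m.inner_vec_right, m.Lmul_eq, comp_apply, comp_apply, mul_comm]

lemma kSuper_iff (bH : HilbertBasis ιH ℂ H) (m : HSModel e H) (x0 : H) (k : ℕ) (D : H →L[ℂ] H) :
    kSuper bH m x0 k D ↔ ∀ ε : ℝ, 0 < ε → ∃ (n : ℕ) (x : Fin n → H),
      (∀ i, x i ∈ {x | ∃ V, rankLE V k ∧ m.Lmul V x0 = x}) ∧
        traceNorm (D - ∑ i, rankOne (x i) (x i)) < ε := by
  refine forall₂_congr fun ε hε => ⟨?_, ?_⟩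
  · rintro ⟨ψ, Ψ, Ψst, ⟨n, V, hV, hψ⟩, hext, hnp, hlt⟩
    exact ⟨n, fun i => m.Lmul (V i) x0, fun i => ⟨V i, hV i, rfl⟩,
      by rwa [← predual_rankOne_of_sum_Ad hψ hext hnp]⟩
  · rintro ⟨n, x, hx, hlt⟩
    choose V hV hVx using hx
    have hψ : ∀ X, elementary (fun i => star (V i)) V X = ∑ i, star (V i) * X * V i := fun X => by
      simp only [elementary_apply, mul_def, comp_assoc]
    have hext := hsExt_elementary m (fun i => star (V i)) V
    have hnp := isNormalPair_elementary bH (fun i => m.Lmul (star (V i))) fun i => m.Lmul (V i)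
    refine ⟨_, _, _, ⟨n, V, hV, hψ⟩, hext, hnp, ?_⟩
    rw [predual_rankOne_of_sum_Ad hψ hext hnp]
    simpa only [hVx] using hlt

lemma kSuper_iff_pairing_nonneg (bH : HilbertBasis ιH ℂ H) (m : HSModel e H) (x0 : H) (k : ℕ)
    {D : H →L[ℂ] H} (hD : IsTraceClass D) : kSuper bH m x0 k D ↔
      ∀ A, (∀ V, rankLE V k → 0 ≤ ⟪m.Lmul V x0, A (m.Lmul V x0)⟫) → 0 ≤ pairing bH A D := by
  rw [kSuper_iff, closed_cone_iff_pairing_nonneg bH _ _ hD]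
  · simp
  · rintro c _ ⟨V, hV, rfl⟩
    refine ⟨(c : ℂ) • V, hV.smul _, m.inj ?_⟩
    rw [map_smul, m.Lmul_eq, m.Lmul_eq, smul_comp]

theorem kSuper_iff_mem_schmidtCone (bH : HilbertBasis ιH ℂ H)
    (hcyc : Dense {y : H | ∃ a : K →L[ℂ] K, m.Lmul a x0 = y})
    {D : H →L[ℂ] H} (hD : IsTraceClass D) : kSuper bH m x0 k D ↔ D ∈ SchmidtCone m k := by
  rw [kSuper_iff_pairing_nonneg bH m x0 k hD, mem_schmidtCone_iff bH hD]
  refine forall_congr' fun A => imp_congr_left ⟨fun h x hx => ?_, fun h V hV => h _ ?_⟩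
  · set R := LinearMap.range (m.toOp x : K →ₗ[ℂ] K) with hR
    have : Module.Finite ℂ R :=
      Module.rank_lt_aleph0_iff.1 (lt_of_le_of_lt hx Cardinal.natCast_lt_aleph0)
    have hp : rankLE R.starProjection k := by
      refine le_trans (Submodule.rank_mono ?_) hx
      rintro _ ⟨v, rfl⟩
      exact Submodule.starProjection_apply_mem _ _
    have hpx : m.Lmul R.starProjection x = x := by
      apply m.inj
      ext v
      rw [m.Lmul_eq, comp_apply]
      exact Submodule.starProjection_eq_self_iff.2 (LinearMap.mem_range_self _ v)
    have hnn : ∀ y, 0 ≤ ⟪y, (adjoint (m.Lmul R.starProjection) ∘L A ∘L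
        m.Lmul R.starProjection) y⟫ := by
      refine forall_nonneg_of_dense hcyc ?_
      rintro _ ⟨a, rfl⟩
      have h1 : m.Lmul R.starProjection (m.Lmul a x0) = m.Lmul (R.starProjection ∘L a) x0 := by
        apply m.inj
        rw [m.Lmul_eq, m.Lmul_eq, m.Lmul_eq, comp_assoc]
      rw [comp_apply, adjoint_inner_right, comp_apply, h1]
      exact h _ (hp.comp_right a)
    have := hnn x
    rwa [comp_apply, adjoint_inner_right, comp_apply, hpx] at this
  · rw [m.Lmul_eq]
    exact hV.comp_right _

end Superpositive

/-! ### Partially entanglement breaking maps -/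

section EntanglementBreaking

variable {K : Type*} [NormedAddCommGroup K] [InnerProductSpace ℂ K] [CompleteSpace K]
  {H : Type*} [NormedAddCommGroup H] [InnerProductSpace ℂ H] [CompleteSpace H]
  {ι ιH : Type*} {e : HilbertBasis ι ℂ K} {bH : HilbertBasis ιH ℂ H} {m : HSModel e H}
  {φ ψ : (K →L[ℂ] K) →ₗ[ℂ] (K →L[ℂ] K)} {Φ Φst Ψ Ψst : (H →L[ℂ] H) →ₗ[ℂ] (H →L[ℂ] H)}
  {k : ℕ} {x0 : H}

lemma adjoint_apply_eq_zero_of_separating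
    (hsep : ∀ a : K →L[ℂ] K, m.Lmul a x0 = 0 → m.Lmul a = 0) {w : K}
    (hw : adjoint (m.toOp x0) w = 0) : w = 0 := by
  have h1 : m.Lmul (rankOne w w) x0 = 0 := by
    apply m.inj
    ext v
    rw [m.Lmul_eq, comp_apply, rankOne_apply, ← adjoint_inner_left, hw]
    simp
  have h2 : m.toOp (m.Lmul (rankOne w w) (m.vec w w)) w = 0 := by simp [hsep _ h1]
  rw [m.Lmul_vec, m.toOp_vec, rankOne_apply, rankOne_apply] at h2
  by_contra hne
  simp [hne] at h2

/-- The right multiplier `∑ₛ x₀* gₛ ⊠ fₛ`. -/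
def rightMultiplier (m : HSModel e H) (x0 : H) {N : ℕ} (g f : Fin N → K) : K →L[ℂ] K :=
  ∑ s, rankOne (adjoint (m.toOp x0) (g s)) (f s)

lemma dense_rightMultiplier (hsep : ∀ a : K →L[ℂ] K, m.Lmul a x0 = 0 → m.Lmul a = 0) :
    Dense {y : H | ∃ (N : ℕ) (g f : Fin N → K), m.Rmul (rightMultiplier m x0 g f) x0 = y} := by
  have h := dense_finite_sums (fun g f => m.vec (m.toOp x0 (adjoint (m.toOp x0) g)) f)
    (fun c g f => by rw [m.smul_vec, map_smul, map_smul]) fun x hx => by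
      apply m.inj
      ext v
      rw [map_zero, zero_apply]
      apply adjoint_apply_eq_zero_of_separating hsep
      rw [← inner_self_eq_zero (𝕜 := ℂ), adjoint_inner_right, ← m.inner_vec_left]
      exact hx _ _
  refine h.mono ?_
  rintro _ ⟨N, g, f, rfl⟩
  refine ⟨N, g, f, m.inj ?_⟩
  ext v
  simp [rightMultiplier, m.Rmul_eq]

lemma forall_predual_mem_schmidtCone_iff (hnp : IsNormalPair bH Φ Φst) :
    (∀ x, Φst (rankOne x x) ∈ SchmidtCone m k) ↔
      ∀ A, BlockPos m k A → ∀ x, 0 ≤ ⟪x, Φ A x⟫ := by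
  simp only [mem_schmidtCone_iff bH (hnp.isTraceClass _ _), hnp.pairing_predual]
  exact ⟨fun h A hA x => h x A hA, fun h x A hA => h A hA x⟩

lemma forall_predual_mem_schmidtCone
    (hsep : ∀ a : K →L[ℂ] K, m.Lmul a x0 = 0 → m.Lmul a = 0)
    (hext : HSExt m φ Φ) (hnp : IsNormalPair bH Φ Φst)
    (h : Φst (rankOne x0 x0) ∈ SchmidtCone m k) (x : H) :
    Φst (rankOne x x) ∈ SchmidtCone m k := by
  refine (forall_predual_mem_schmidtCone_iff hnp).2 (fun A hA => ?_) x
  refine forall_nonneg_of_dense (dense_rightMultiplier hsep) ?_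
  rintro _ ⟨N, g, f, rfl⟩
  rw [inner_Rmul_map hext hnp]
  refine (mem_schmidtCone_iff bH (hnp.isTraceClass _ _)).1 h _ fun x hx => ?_
  rw [comp_apply, adjoint_inner_right, comp_apply]
  refine hA _ ?_
  rw [m.Rmul_eq]
  exact hx.comp_right _

lemma predual_mem_schmidtCone_of_isPositive (hnp : IsNormalPair bH Φ Φst)
    (h : ∀ x, Φst (rankOne x x) ∈ SchmidtCone m k) {R : H →L[ℂ] H} (hR : IsTraceClass R)
    (hpos : R.IsPositive) : Φst R ∈ SchmidtCone m k := by
  rw [mem_schmidtCone_iff bH (hnp.1 R hR)]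
  intro A hA
  rw [← hnp.2 A R hR]
  exact pairing_nonneg bH hR (fun x => hpos.inner_nonneg_right x)
    (isPositive_of_inner_nonneg ((forall_predual_mem_schmidtCone_iff hnp).1 h A hA))

lemma isPositive_rankOne_self (x : H) : (rankOne x x).IsPositive :=
  isPositive_of_inner_nonneg fun y => by
    rw [rankOne_apply, inner_smul_right, ← inner_conj_symm x y, mul_comm]
    exact mul_star_self_nonneg _

lemma tr_rankOne_self {x : H} (hx : ‖x‖ = 1) : tr bH (rankOne x x) = 1 := by
  have h := pairing_rankOne bH (ContinuousLinearMap.id ℂ H) x x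
  rw [id_apply, inner_self_eq_norm_sq_to_K, hx] at h
  simpa [pairing] using h

lemma exists_toOp_apply_eq (m : HSModel e H) {n : ℕ} (h : Fin n → K) :
    ∃ x, ∀ l, m.toOp x (h l) = h l := by
  set S := Submodule.span ℂ (Set.range h)
  have hfin : FiniteDimensional ℂ S := FiniteDimensional.span_of_finite ℂ (Set.finite_range h)
  let o := stdOrthonormalBasis ℂ S
  refine ⟨∑ i, m.vec (o i) (o i), fun l => ?_⟩
  have h1 : S.starProjection (h l) = h l :=
    Submodule.starProjection_eq_self_iff.2 (Submodule.subset_span ⟨l, rfl⟩)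
  rw [o.starProjection_eq_sum_rankOne] at h1
  simpa using h1

lemma kPos_comp_of_forall_predual_mem (hext : HSExt m φ Φ) (hnp : IsNormalPair bH Φ Φst)
    (h : ∀ x, Φst (rankOne x x) ∈ SchmidtCone m k) (hψ : kPos k ψ) (n : ℕ) :
    kPos n (φ ∘ₗ ψ) := by
  intro X hX v
  obtain ⟨x, hx⟩ := exists_toOp_apply_eq m v
  have h1 := (forall_predual_mem_schmidtCone_iff hnp).1 h
    (∑ l, ∑ j, m.Rmul (rankOne (v j) (v l)) ∘L m.Lmul (ψ (X l j))) (fun y hy => by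
      simp only [sum_apply, inner_sum, m.inner_Rmul_rankOne_Lmul]
      exact hψ.sum_inner_nonneg hy hX v) x
  simp only [map_sum, hext _ _, sum_apply, inner_sum, m.inner_Rmul_rankOne_Lmul, hx] at h1
  exact h1

lemma isPositive_map_map (hext : HSExt m φ Φ) (hnp : IsNormalPair bH Φ Φst)
    (hextψ : HSExt m ψ Ψ) (hnpψ : IsNormalPair bH Ψ Ψst) (hcp : ∀ n, kPos n (φ ∘ₗ ψ)) (z : H) :
    (Φ (Ψ (rankOne z z))).IsPositive :=
  isPositive_of_inner_nonneg fun x => inner_map_rankOne_nonneg (hext.comp hextψ)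
    (hnp.continuous.comp hnpψ.continuous) x
    (fun n u _ => hcp n _ (matPos_rankOne u) _) z

lemma isPositive_predual (hextψ : HSExt m ψ Ψ) (hnpψ : IsNormalPair bH Ψ Ψst)
    (hψ : kPos k ψ) {D : H →L[ℂ] H} (hD : IsTraceClass D) (h : D ∈ SchmidtCone m k) :
    (Ψst D).IsPositive :=
  isPositive_of_inner_nonneg fun z => by
    rw [← rankOne_pairing bH (hnpψ.1 D hD), ← hnpψ.2 _ D hD]
    exact (mem_schmidtCone_iff bH hD).1 h _ (hψ.blockPos_map hextψ hnpψ.continuous z)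

end EntanglementBreaking

/-! ### Compressions to finitely many coordinates -/

section Compression

variable {E : Type*} [NormedAddCommGroup E] [InnerProductSpace ℂ E] [CompleteSpace E]

lemma tendsto_pairing_compression {ι α : Type*} {l : Filter α} (b : HilbertBasis ι ℂ E)
    {T : E →L[ℂ] E} (hT : IsTraceClass T) (A : E →L[ℂ] E) {P : α → E →L[ℂ] E}
    (hnorm : ∀ a x, ‖P a x‖ ≤ ‖x‖) (hlim : ∀ x, Filter.Tendsto (fun a => P a x) l (nhds x)) :
    Filter.Tendsto (fun a => pairing b (adjoint (P a) ∘L A ∘L P a) T) l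
      (nhds (pairing b A T)) := by
  obtain ⟨x, y, h⟩ := hT
  simp only [NuclearRep.pairing_eq b h, comp_apply, adjoint_inner_right]
  refine tendsto_tsum_of_dominated_convergence (h.1.mul_left ‖A‖) (fun n => ?_)
    (Filter.Eventually.of_forall fun a n => ?_)
  · exact (hlim (y n)).inner ((A.continuous.tendsto _).comp (hlim (x n)))
  · refine (norm_inner_apply_le A _ _).trans ?_
    gcongr <;> exact hnorm a _

variable {K : Type*} [NormedAddCommGroup K] [InnerProductSpace ℂ K] [CompleteSpace K]
  {H : Type*} [NormedAddCommGroup H] [InnerProductSpace ℂ H] [CompleteSpace H]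
  {ι : Type*}

/-- The orthogonal projection onto the span of the `eᵢ` with `i ∈ F`. -/
def coordProj (e : HilbertBasis ι ℂ K) (F : Finset ι) : K →L[ℂ] K :=
  ∑ i ∈ F, rankOne (e i) (e i)

lemma coordProj_apply (e : HilbertBasis ι ℂ K) (F : Finset ι) (v : K) :
    coordProj e F v = ∑ i ∈ F, ⟪e i, v⟫ • e i := by
  simp [coordProj]

lemma norm_coordProj_apply_le (e : HilbertBasis ι ℂ K) (F : Finset ι) (v : K) :
    ‖coordProj e F v‖ ≤ ‖v‖ := by
  refine le_of_sq_le_sq ?_ (norm_nonneg _)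
  refine le_of_eq_of_le ?_ (e.orthonormal.sum_inner_products_le (s := F) v)
  have h := e.orthonormal.inner_sum (fun i => ⟪e i, v⟫) (fun i => ⟪e i, v⟫) F
  rw [← coordProj_apply, inner_self_eq_norm_sq_to_K] at h
  simp only [RCLike.conj_mul] at h
  exact_mod_cast h

lemma tendsto_coordProj_apply (e : HilbertBasis ι ℂ K) (v : K) :
    Filter.Tendsto (fun F => coordProj e F v) Filter.atTop (nhds v) := by
  have h := e.hasSum_repr v
  simp only [e.repr_apply_apply] at h
  simp only [coordProj_apply]
  exact h

variable {e : HilbertBasis ι ℂ K} (m : HSModel e H)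

lemma norm_Lmul_coordProj_apply_le (F : Finset ι) (x : H) :
    ‖m.Lmul (coordProj e F) x‖ ≤ ‖x‖ := by
  refine le_of_sq_le_sq ?_ (norm_nonneg _)
  refine hasSum_le (fun i => ?_) (m.norm_sq_eq _) (m.norm_sq_eq x)
  rw [m.Lmul_eq]
  exact pow_le_pow_left₀ (norm_nonneg _) (norm_coordProj_apply_le e F _) 2

lemma tendsto_Lmul_coordProj_apply (x : H) :
    Filter.Tendsto (fun F => m.Lmul (coordProj e F) x) Filter.atTop (nhds x) := by
  rw [tendsto_iff_norm_sub_tendsto_zero]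
  have h1 : Filter.Tendsto (fun F => ‖m.Lmul (coordProj e F) x - x‖ ^ 2) Filter.atTop
      (nhds 0) := by
    have h2 : ∀ F, ‖m.Lmul (coordProj e F) x - x‖ ^ 2 =
        ∑' i, ‖coordProj e F (m.toOp x (e i)) - m.toOp x (e i)‖ ^ 2 := fun F => by
      rw [← (m.norm_sq_eq _).tsum_eq]
      simp [m.Lmul_eq]
    simp only [h2]
    rw [show (0 : ℝ) = ∑' _ : ι, (0 : ℝ) by simp]
    refine tendsto_tsum_of_dominated_convergence ((m.norm_sq_eq x).summable.mul_left 4)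
      (fun i => ?_) (Filter.Eventually.of_forall fun F i => ?_)
    · have h3 := tendsto_iff_norm_sub_tendsto_zero.1 (tendsto_coordProj_apply e (m.toOp x (e i)))
      simpa using h3.pow 2
    · rw [Real.norm_of_nonneg (by positivity)]
      have h4 := norm_sub_le (coordProj e F (m.toOp x (e i))) (m.toOp x (e i))
      have h5 := norm_coordProj_apply_le e F (m.toOp x (e i))
      calc _ ≤ (2 * ‖m.toOp x (e i)‖) ^ 2 := by gcongr; linarith
        _ = _ := by ring
  have h6 := h1.sqrt
  simpa using h6

end Compression

/-! ### Recovering the cone from the Choi operators of `k`-positive maps -/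

section Recovery

lemma exists_factor_of_quadratic_nonneg {α : Type*} [Fintype α] (Y : α → α → ℂ)
    (h : ∀ c : α → ℂ, 0 ≤ ∑ a, ∑ b, starRingEnd ℂ (c a) * Y a b * c b) :
    ∃ C : α → α → ℂ, ∀ a b, Y a b = ∑ r, starRingEnd ℂ (C r a) * C r b := by
  classical
  let T := Matrix.toEuclideanCLM (n := α) (𝕜 := ℂ) (Matrix.of Y)
  have hT : ∀ v w : EuclideanSpace ℂ α,
      ⟪v, T w⟫ = ∑ a, ∑ b, starRingEnd ℂ (v a) * Y a b * w b := fun v w => by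
    rw [EuclideanSpace.inner_eq_star_dotProduct, Matrix.ofLp_toEuclideanCLM]
    simp only [dotProduct, Matrix.mulVec, Matrix.of_apply, Finset.sum_mul, Pi.star_apply,
      RCLike.star_def]
    refine Finset.sum_congr rfl fun a _ => Finset.sum_congr rfl fun b _ => ?_
    ring
  have hpos : T.IsPositive := isPositive_of_inner_nonneg fun v => by
    rw [hT]
    exact h _
  obtain ⟨S, hS⟩ := CStarAlgebra.nonneg_iff_eq_star_mul_self.1
    ((ContinuousLinearMap.nonneg_iff_isPositive T).2 hpos)
  refine ⟨fun r a => S (EuclideanSpace.single a 1) r, fun a b => ?_⟩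
  have h1 := hT (EuclideanSpace.single a 1) (EuclideanSpace.single b 1)
  rw [hS, mul_def, comp_apply, star_eq_adjoint, adjoint_inner_right, PiLp.inner_apply] at h1
  have h2 : ∑ a', ∑ b', starRingEnd ℂ ((EuclideanSpace.single a (1 : ℂ) : EuclideanSpace ℂ α) a') *
      Y a' b' * (EuclideanSpace.single b (1 : ℂ) : EuclideanSpace ℂ α) b' = Y a b := by
    rw [Finset.sum_eq_single a (by intro c _ hc; simp [hc]) (by simp),
      Finset.sum_eq_single b (by intro c _ hc; simp [hc]) (by simp)]
    simp
  rw [← h2, ← h1]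
  exact Finset.sum_congr rfl fun r _ => mul_comm _ _

variable {K : Type*} [NormedAddCommGroup K] [InnerProductSpace ℂ K] [CompleteSpace K]
  {H : Type*} [NormedAddCommGroup H] [InnerProductSpace ℂ H] [CompleteSpace H]
  {ι ιH : Type*} {e : HilbertBasis ι ℂ K} {bH : HilbertBasis ιH ℂ H} {m : HSModel e H}
  {φ : (K →L[ℂ] K) →ₗ[ℂ] (K →L[ℂ] K)} {Φ Φst : (H →L[ℂ] H) →ₗ[ℂ] (H →L[ℂ] H)}
  {k : ℕ} {x0 : H} {β : Type*} [Fintype β] {N : ℕ}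

lemma adjoint_rankOne (u v : K) : adjoint (rankOne u v) = rankOne v u := by
  refine (eq_adjoint_iff _ _).2 (fun x y => ?_) |>.symm
  rw [rankOne_apply, rankOne_apply, inner_smul_left, inner_smul_right, inner_conj_symm, mul_comm]

lemma MatPos.exists_factor {X : Fin k → Fin k → (K →L[ℂ] K)} (hX : MatPos X) (g : Fin N → K) :
    ∃ C : Fin k × Fin N → Fin k × Fin N → ℂ, ∀ a b,
      ⟪g a.2, X a.1 b.1 (g b.2)⟫ = ∑ r, starRingEnd ℂ (C r a) * C r b := by
  refine exists_factor_of_quadratic_nonneg _ fun c => ?_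
  refine (hX fun l => ∑ s, c (l, s) • g s).trans_eq ?_
  rw [Fintype.sum_prod_type]
  refine Finset.sum_congr rfl fun l _ => ?_
  simp only [Fintype.sum_prod_type, sum_inner]
  rw [Finset.sum_comm]
  refine Finset.sum_congr rfl fun s _ => Finset.sum_congr rfl fun j _ => ?_
  rw [map_sum, inner_sum]
  refine Finset.sum_congr rfl fun t _ => ?_
  rw [map_smul, inner_smul_left, inner_smul_right]
  ring

/-- The map on `B(K)` whose Choi operator is the compression of `A` by `∑ₐ wₐ ⊠ L_{Vₐ} x0`, where
`wₐ = uᵢ ⊠ fₛ` and `Vₐ = uᵢ ⊠ gₛ` for `a = (i, s)`. -/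
def compressionMap (m : HSModel e H) (A : H →L[ℂ] H) (u : β → K) (g f : Fin N → K) :
    (K →L[ℂ] K) →ₗ[ℂ] (K →L[ℂ] K) :=
  elementary (α := (β × Fin N) × (β × Fin N))
    (fun p => ⟪m.vec (u p.1.1) (f p.1.2), A (m.vec (u p.2.1) (f p.2.2))⟫ •
      rankOne (u p.1.1) (g p.1.2))
    (fun p => rankOne (g p.2.2) (u p.2.1))

lemma kPos_compressionMap {A : H →L[ℂ] H} (hA : BlockPos m k A) (u : β → K) (g f : Fin N → K) :
    kPos k (compressionMap m A u g f) := by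
  intro X hX h
  obtain ⟨C, hC⟩ := hX.exists_factor g
  let ζ : Fin k × Fin N → H := fun r => ∑ p : Fin k × (β × Fin N),
    (C r (p.1, p.2.2) * ⟪u p.2.1, h p.1⟫) • m.vec (u p.2.1) (f p.2.2)
  have hζ : ∀ r, rankLE (m.toOp (ζ r)) k := fun r => by
    refine rankLE_of_forall_mem_span (fun l => ∑ i, ⟪u i, h l⟫ • u i) fun v => ?_
    have : m.toOp (ζ r) v =
        ∑ l, (∑ s, C r (l, s) * ⟪f s, v⟫) • ∑ i, ⟪u i, h l⟫ • u i := by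
      simp only [ζ, map_sum, map_smul, m.toOp_vec, sum_apply, smul_apply, rankOne_apply,
        Fintype.sum_prod_type, Finset.smul_sum, smul_smul]
      refine Finset.sum_congr rfl fun l _ => Finset.sum_congr rfl fun i _ => ?_
      rw [← Finset.sum_smul, Finset.sum_mul]
      congr 1
      refine Finset.sum_congr rfl fun s _ => ?_
      ring
    rw [this]
    exact Submodule.sum_mem _ fun l _ => Submodule.smul_mem _ _ (Submodule.subset_span ⟨l, rfl⟩)
  refine (Finset.sum_nonneg (s := Finset.univ) fun r _ => hA (ζ r) (hζ r)).trans_eq (Eq.symm ?_)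
  have h1 : ∀ l j, ⟪h l, compressionMap m A u g f (X l j) (h j)⟫ =
      ∑ a : β × Fin N, ∑ b : β × Fin N, ∑ r,
        starRingEnd ℂ (C r (l, a.2) * ⟪u a.1, h l⟫) * (C r (j, b.2) * ⟪u b.1, h j⟫) *
          ⟪m.vec (u a.1) (f a.2), A (m.vec (u b.1) (f b.2))⟫ := fun l j => by
    rw [compressionMap, elementary_apply, sum_apply, inner_sum, Fintype.sum_prod_type]
    refine Finset.sum_congr rfl fun a _ => Finset.sum_congr rfl fun b _ => ?_
    have h2 := hC (l, a.2) (j, b.2)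
    simp only [comp_apply, smul_apply, rankOne_apply, map_smul, inner_smul_right] at h2 ⊢
    rw [h2, ← inner_conj_symm (h l) (u a.1), Finset.sum_mul,
      Finset.mul_sum, Finset.mul_sum]
    refine Finset.sum_congr rfl fun r _ => ?_
    rw [map_mul]
    ring
  have h3 : ∀ r, ⟪ζ r, A (ζ r)⟫ = ∑ j, ∑ b : β × Fin N, ∑ l, ∑ a : β × Fin N,
      starRingEnd ℂ (C r (l, a.2) * ⟪u a.1, h l⟫) * (C r (j, b.2) * ⟪u b.1, h j⟫) *
          ⟪m.vec (u a.1) (f a.2), A (m.vec (u b.1) (f b.2))⟫ := fun r => by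
    simp only [ζ, map_sum, map_smul, sum_inner, inner_sum, inner_smul_left, inner_smul_right]
    rw [Fintype.sum_prod_type]
    refine Finset.sum_congr rfl fun j _ => Finset.sum_congr rfl fun b _ => ?_
    rw [Fintype.sum_prod_type, Finset.mul_sum]
    refine Finset.sum_congr rfl fun l _ => ?_
    rw [Finset.mul_sum]
    refine Finset.sum_congr rfl fun a _ => ?_
    ring
  simp only [h1, h3]
  rw [Finset.sum_comm, Finset.sum_comm (s := (Finset.univ : Finset (Fin k × Fin N)))]
  refine Finset.sum_congr rfl fun j _ => ?_
  rw [Finset.sum_comm (s := (Finset.univ : Finset (Fin k × Fin N)))]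
  refine ((Finset.sum_congr rfl fun l _ => Finset.sum_comm).trans Finset.sum_comm).trans ?_
  refine Finset.sum_congr rfl fun b _ => ?_
  rw [Finset.sum_comm (s := (Finset.univ : Finset (Fin k × Fin N)))]
  exact Finset.sum_congr rfl fun l _ => Finset.sum_comm

lemma Lmul_rankOne_apply (u g : K) (x : H) :
    m.Lmul (rankOne u g) x = m.vec u (adjoint (m.toOp x) g) := by
  apply m.inj
  ext v
  simp [m.Lmul_eq, adjoint_inner_left]

lemma choi_compressionMap (A : H →L[ℂ] H) (F : Finset ι) (g f : Fin N → K) :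
    elementary (α := (F × Fin N) × (F × Fin N))
      (fun p => m.Lmul (⟪m.vec (e p.1.1) (f p.1.2), A (m.vec (e p.2.1) (f p.2.2))⟫ •
        rankOne (e p.1.1) (g p.1.2)))
      (fun p => m.Lmul (rankOne (g p.2.2) (e p.2.1))) (rankOne x0 x0) =
    adjoint (m.Rmul (rightMultiplier m x0 g f)) ∘L
      (adjoint (m.Lmul (coordProj e F)) ∘L A ∘L m.Lmul (coordProj e F)) ∘L
        m.Rmul (rightMultiplier m x0 g f) := by
  have hz : ∀ x : H, m.Lmul (coordProj e F) (m.Rmul (rightMultiplier m x0 g f) x) =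
      ∑ a : F × Fin N, ⟪m.Lmul (rankOne (e a.1) (g a.2)) x0, x⟫ • m.vec (e a.1) (f a.2) :=
    fun x => by
      apply m.inj
      ext v
      simp only [m.Lmul_eq, m.Rmul_eq, rightMultiplier, comp_apply, coordProj_apply, map_sum,
        map_smul, sum_apply, smul_apply, m.toOp_vec, rankOne_apply, Lmul_rankOne_apply,
        m.inner_vec_left, Finset.smul_sum, smul_smul,
        Fintype.sum_prod_type]
      rw [Finset.sum_comm, ← Finset.sum_coe_sort F]
      refine Finset.sum_congr rfl fun i _ => Finset.sum_congr rfl fun s _ => ?_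
      rw [mul_comm]
  ext x
  refine ext_inner_left ℂ fun y => ?_
  simp only [comp_apply, adjoint_inner_right]
  rw [hz, hz]
  have hadj : ∀ b : F × Fin N, ⟪x0, m.Lmul (rankOne (g b.2) (e b.1)) x⟫ =
      ⟪m.Lmul (rankOne (e b.1) (g b.2)) x0, x⟫ := fun b => by
    rw [← adjoint_rankOne (e b.1 : K), ← m.adjoint_Lmul, adjoint_inner_right]
  have hsmul : ∀ (c : ℂ) (V : K →L[ℂ] K) (x : H), m.Lmul (c • V) x = c • m.Lmul V x :=
    fun c V x => m.inj (by rw [map_smul, m.Lmul_eq, m.Lmul_eq, smul_comp])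
  simp only [elementary_apply, sum_apply, comp_apply, rankOne_apply, map_smul, hadj, hsmul,
    inner_sum, sum_inner, map_sum, inner_smul_left, inner_smul_right]
  rw [Fintype.sum_prod_type, Finset.sum_comm]
  refine Finset.sum_congr rfl fun b _ => ?_
  rw [Finset.mul_sum]
  refine Finset.sum_congr rfl fun a _ => ?_
  rw [← inner_conj_symm y]
  ring

theorem mem_schmidtCone_of_forall_pairing_nonneg
    (hsep : ∀ a : K →L[ℂ] K, m.Lmul a x0 = 0 → m.Lmul a = 0)
    (hext : HSExt m φ Φ) (hnp : IsNormalPair bH Φ Φst)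
    (h : ∀ (ψ : (K →L[ℂ] K) →ₗ[ℂ] (K →L[ℂ] K)) (Ψ Ψst : (H →L[ℂ] H) →ₗ[ℂ] (H →L[ℂ] H)),
      kPos k ψ → NormalCB e ψ → HSExt m ψ Ψ → IsNormalPair bH Ψ Ψst →
      0 ≤ pairing bH (Ψ (rankOne x0 x0)) (Φst (rankOne x0 x0))) :
    Φst (rankOne x0 x0) ∈ SchmidtCone m k := by
  rw [mem_schmidtCone_iff bH (hnp.isTraceClass _ _)]
  intro A hA
  have hlim := tendsto_pairing_compression bH (hnp.isTraceClass x0 x0) A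
    (norm_Lmul_coordProj_apply_le m) (tendsto_Lmul_coordProj_apply m)
  refine isClosed_Ici.mem_of_tendsto hlim (Filter.Eventually.of_forall fun F => ?_)
  rw [Set.mem_Ici, hnp.pairing_predual]
  refine forall_nonneg_of_dense (dense_rightMultiplier hsep) ?_ x0
  rintro _ ⟨N, g, f, rfl⟩
  rw [inner_Rmul_map hext hnp, ← choi_compressionMap]
  exact h _ _ _ (kPos_compressionMap hA (fun i : F => e i) g f) (normalCB_elementary _ _)
    (hsExt_elementary m _ _) (isNormalPair_elementary bH _ _)

end Recovery

/-- Theorem 6.3.  For a normal completely positive map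
`φ : B(K) → B(K)` (with normal extension `Φ` of `φ̃` and predual `Φst`), the
following are equivalent: (i) `φ` is `k`-superpositive;
(ii) `⟨C_ψ, D_φ⟩ ≥ 0` for every `ψ ∈ P^σ_k`; (iii) `φ ∘ ψ` is completely
positive for every `ψ ∈ P^σ_k`; (iv) `φ̃(C_ψ) ≥ 0` for every `ψ ∈ P^σ_k`;
(v) `ψ̃_*(D_φ) ≥ 0` for every `ψ ∈ P^σ_k`; (vi) `D_φ ∈ 𝒮_k`;
(vii) `φ̃_*(ω_{x,x}) ∈ 𝒮_k` for every `x ∈ H`; (viii) `φ` is `k`-partially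
entanglement breaking, i.e. `φ̃_*` sends every normal state of `T(H)` into
`𝒮_k`. -/
theorem statement17
    {K : Type*} [NormedAddCommGroup K] [InnerProductSpace ℂ K] [CompleteSpace K]
    [TopologicalSpace.SeparableSpace K]
    {ι : Type*} (e : HilbertBasis ι ℂ K)
    {H : Type*} [NormedAddCommGroup H] [InnerProductSpace ℂ H] [CompleteSpace H]
    {ιH : Type*} (bH : HilbertBasis ιH ℂ H)
    (m : HSModel e H) (x0 : H) (hx0 : ‖x0‖ = 1)
    (hcyc : Dense {y : H | ∃ a : K →L[ℂ] K, m.Lmul a x0 = y})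
    (hsep : ∀ a : K →L[ℂ] K, m.Lmul a x0 = 0 → m.Lmul a = 0)
    (k : ℕ)
    (φ : (K →L[ℂ] K) →ₗ[ℂ] (K →L[ℂ] K))
    (hnormal : ∃ φst, IsNormalPair e φ φst) (hcp : ∀ n : ℕ, kPos n φ)
    (Φ Φst : (H →L[ℂ] H) →ₗ[ℂ] (H →L[ℂ] H))
    (hext : HSExt m φ Φ) (hnp : IsNormalPair bH Φ Φst) :
    List.TFAE [
      kSuper bH m x0 k (Φst (rankOne x0 x0)),
      ∀ (ψ : (K →L[ℂ] K) →ₗ[ℂ] (K →L[ℂ] K)) (Ψ Ψst : (H →L[ℂ] H) →ₗ[ℂ] (H →L[ℂ] H)),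
        kPos k ψ → NormalCB e ψ → HSExt m ψ Ψ → IsNormalPair bH Ψ Ψst →
        0 ≤ pairing bH (Ψ (rankOne x0 x0)) (Φst (rankOne x0 x0)),
      ∀ ψ : (K →L[ℂ] K) →ₗ[ℂ] (K →L[ℂ] K), kPos k ψ → NormalCB e ψ →
        ∀ n : ℕ, kPos n (φ ∘ₗ ψ),
      ∀ (ψ : (K →L[ℂ] K) →ₗ[ℂ] (K →L[ℂ] K)) (Ψ Ψst : (H →L[ℂ] H) →ₗ[ℂ] (H →L[ℂ] H)),
        kPos k ψ → NormalCB e ψ → HSExt m ψ Ψ → IsNormalPair bH Ψ Ψst →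
        (Φ (Ψ (rankOne x0 x0))).IsPositive,
      ∀ (ψ : (K →L[ℂ] K) →ₗ[ℂ] (K →L[ℂ] K)) (Ψ Ψst : (H →L[ℂ] H) →ₗ[ℂ] (H →L[ℂ] H)),
        kPos k ψ → NormalCB e ψ → HSExt m ψ Ψ → IsNormalPair bH Ψ Ψst →
        (Ψst (Φst (rankOne x0 x0))).IsPositive,
      Φst (rankOne x0 x0) ∈ SchmidtCone m k,
      ∀ x : H, Φst (rankOne x x) ∈ SchmidtCone m k,
      ∀ R : H →L[ℂ] H, IsTraceClass R → R.IsPositive → tr bH R = 1 →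
        Φst R ∈ SchmidtCone m k] := by
  have hD := hnp.isTraceClass x0 x0
  tfae_have 1 ↔ 6 := kSuper_iff_mem_schmidtCone bH hcyc hD
  tfae_have 6 → 7 := fun h x => forall_predual_mem_schmidtCone hsep hext hnp h x
  tfae_have 7 → 8 := fun h R hR hpos _ => predual_mem_schmidtCone_of_isPositive hnp h hR hpos
  tfae_have 8 → 6 := fun h =>
    h _ (isTraceClass_rankOne x0 x0) (isPositive_rankOne_self x0) (tr_rankOne_self hx0)
  tfae_have 7 → 3 := fun h ψ hψ _ n => kPos_comp_of_forall_predual_mem hext hnp h hψ n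
  tfae_have 3 → 4 := fun h ψ Ψ Ψst hψ hn he hp =>
    isPositive_map_map hext hnp he hp (h ψ hψ hn) x0
  tfae_have 4 → 2 := fun h ψ Ψ Ψst hψ hn he hp => by
    rw [hnp.pairing_predual]
    exact (h ψ Ψ Ψst hψ hn he hp).inner_nonneg_right x0
  tfae_have 6 → 5 := fun h ψ Ψ Ψst hψ hn he hp => isPositive_predual he hp hψ hD h
  tfae_have 5 → 2 := fun h ψ Ψ Ψst hψ hn he hp => by
    rw [hp.2 _ _ hD, rankOne_pairing bH (hp.1 _ hD)]
    exact (h ψ Ψ Ψst hψ hn he hp).inner_nonneg_right x0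
  tfae_have 2 → 6 := mem_schmidtCone_of_forall_pairing_nonneg hsep hext hnp
  tfae_finish

end ChoiInf
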